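/- arXiv:1902.00158 — 5 statements merged into one kernel-verified Lean document; each statement's English description precedes it below -/
import Mathlib

section
/- Let 0 < δ < 1/4 and let u be a classical solution of the one-phase free boundary problem in the annulus A = B₁ ∖ closure(B_δ) ⊆ ℝ² satisfying condition (A). Then: (i) if x₀ ∈ F(u) and ρ is the supremum of radii r with B_r(x₀) ⊆ A, then sup_{B_r(x₀)} u = max_{∂B_r(x₀)} u ≥ r/(4π) for all 0 < r < ρ; (ii) there exist absolute constants c > 0 and c̃ > 0 such that max_{∂B_r} u ≥ c r for all r with c̃ δ log(1/δ) < r < 1. -/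
open Complex Metric Set Filter MeasureTheory
open scoped Topology Classical NNReal

noncomputable section

/-- The positive phase of `u` in `Ω`. -/
def posSet (Ω : Set ℂ) (u : ℂ → ℝ) : Set ℂ := {z ∈ Ω | 0 < u z}

/-- The free boundary of `u` in `Ω`. -/
def FB (Ω : Set ℂ) (u : ℂ → ℝ) : Set ℂ := Ω ∩ frontier (posSet Ω u)

/-- The gradient of `u : ℂ → ℝ`, viewed as a complex number `∂ₓu + i ∂ᵧu`. -/
def grad2 (u : ℂ → ℝ) (z : ℂ) : ℂ :=
  ((fderiv ℝ u z 1 : ℝ) : ℂ) + ((fderiv ℝ u z Complex.I : ℝ) : ℂ) * Complex.I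

/-- Second derivative (Hessian) of `u : ℂ → ℝ` at `z` in directions `v, w`. -/
def hess (u : ℂ → ℝ) (z v w : ℂ) : ℝ := fderiv ℝ (fun x => fderiv ℝ u x v) z w

/-- `u` is harmonic on `s`: twice continuously differentiable with vanishing Laplacian. -/
def HarmonicOn2 (u : ℂ → ℝ) (s : Set ℂ) : Prop :=
  ContDiffOn ℝ 2 u s ∧ ∀ z ∈ s, hess u z 1 1 + hess u z Complex.I Complex.I = 0

/-- A classical solution of the one-phase free boundary problem `Δu = 0` in `{u>0}`,
`|∇u| = 1` on the free boundary, in the open set `Ω ⊆ ℝ² ≅ ℂ`. -/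
structure IsClassicalSolution (Ω : Set ℂ) (u : ℂ → ℝ) : Prop where
  contOn : ContinuousOn u Ω
  nonneg : ∀ z ∈ Ω, 0 ≤ u z
  harm : HarmonicOn2 u (posSet Ω u)
  smooth_ext : ∃ v : ℂ → ℝ, ContDiffOn ℝ (⊤ : ℕ∞) v (Ω ∩ closure (posSet Ω u)) ∧
    Set.EqOn u v (Ω ∩ closure (posSet Ω u))
  fb_manifold : ∀ z ∈ FB Ω u, ∃ V : Set ℂ, IsOpen V ∧ z ∈ V ∧ V ⊆ Ω ∧
    ∃ φ : ℂ → ℝ, ContDiffOn ℝ (⊤ : ℕ∞) φ V ∧ (∀ w ∈ V, fderiv ℝ φ w ≠ 0) ∧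
      V ∩ posSet Ω u = {w ∈ V | 0 < φ w} ∧
      V ∩ {w | u w = 0} = {w ∈ V | φ w ≤ 0} ∧
      V ∩ FB Ω u = {w ∈ V | φ w = 0}
  grad_one : ∀ z ∈ FB Ω u,
    Filter.Tendsto (fun w => ‖grad2 u w‖) (nhdsWithin z (posSet Ω u)) (nhds 1)

/-- One-plane solution `P(z) = max (Re z) 0`. -/
def Pfun (z : ℂ) : ℝ := max z.re 0

/-- Wedge solution `W_s(z) = s |Re z|`. -/
def Wfun (s : ℝ) (z : ℂ) : ℝ := s * |z.re|

/-- Two-plane solution `TP_a`. -/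
def TPfun (a : ℝ) (z : ℂ) : ℝ := max z.re 0 + max (-z.re - a) 0

/-- Rotation of the plane by angle `θ`. -/
def rot (θ : ℝ) (z : ℂ) : ℂ := Complex.exp (θ * Complex.I) * z

/-- The strip `S = {|Im ζ| < π/2}`. -/
def Sstrip : Set ℂ := {ζ : ℂ | |ζ.im| < Real.pi / 2}

/-- The hairpin domain `Ω₁ = {|x₂| < π/2 + cosh x₁}`. -/
def Omega1 : Set ℂ := {z : ℂ | |z.im| < Real.pi / 2 + Real.cosh z.re}

/-- Dilated hairpin domain `Ω_a = aΩ₁`. -/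
def OmegaA (a : ℝ) : Set ℂ := {z : ℂ | z / (a : ℂ) ∈ Omega1}

/-- The Hauswirth–Hélein–Pacard double hairpin solution `H = H₁`:
`H(z) = Re (cosh w)` where `w` is the unique point of the strip `S` with `w + sinh w = z`,
and `H(z) = 0` if there is no such point. -/
def hairpinH (z : ℂ) : ℝ :=
  if h : ∃ w : ℂ, w ∈ Sstrip ∧ w + Complex.sinh w = z then (Complex.cosh h.choose).re else 0

/-- The double hairpin solution `H_a(z) = a H(z/a)`. -/
def hairpin (a : ℝ) (z : ℂ) : ℝ := a * hairpinH (z / (a : ℂ))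

/-- Euclidean dot product of two complex numbers viewed as vectors in ℝ². -/
def dot2 (a b : ℂ) : ℝ := a.re * b.re + a.im * b.im

/-- Divergence of a vector field `ψ : ℂ → ℂ` on ℝ². -/
def div2 (ψ : ℂ → ℂ) (z : ℂ) : ℝ := (fderiv ℝ ψ z 1).re + (fderiv ℝ ψ z Complex.I).im

/-- A variational (weak) solution of the one-phase free boundary problem in `Ω`:
`u ∈ H¹_loc(Ω) ∩ C(Ω)`, `u ≥ 0`, `u ∈ C²({u>0})`, and the domain-variation
Euler–Lagrange identity holds for all compactly supported smooth vector fields. -/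
def VariationalSolution (Ω : Set ℂ) (u : ℂ → ℝ) : Prop :=
  ContinuousOn u Ω ∧ (∀ z ∈ Ω, 0 ≤ u z) ∧
  (∀ K : Set ℂ, K ⊆ Ω → IsCompact K →
    MeasureTheory.IntegrableOn (fun z => (u z) ^ 2 + ‖grad2 u z‖ ^ 2) K) ∧
  ContDiffOn ℝ 2 u (posSet Ω u) ∧
  ∀ ψ : ℂ → ℂ, ContDiff ℝ (⊤ : ℕ∞) ψ → HasCompactSupport ψ → tsupport ψ ⊆ Ω →
    ∫ z in Ω, ((‖grad2 u z‖ ^ 2 + Set.indicator {w | 0 < u w} (fun _ => (1 : ℝ)) z) * div2 ψ z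
      - 2 * dot2 (grad2 u z) (fderiv ℝ ψ z (grad2 u z))) = 0

/-- Average of `w` over the circle of radius `r` around `z`. -/
def circleAvg (w : ℂ → ℝ) (z : ℂ) (r : ℝ) : ℝ :=
  (1 / (2 * Real.pi)) * ∫ θ in (0 : ℝ)..(2 * Real.pi), w (z + r * Complex.exp (θ * Complex.I))

/-- Superharmonicity on `s` via the super-mean-value property. -/
def SuperharmonicOn2 (w : ℂ → ℝ) (s : Set ℂ) : Prop :=
  ∀ z ∈ s, ∀ r : ℝ, 0 < r → Metric.closedBall z r ⊆ s → circleAvg w z r ≤ w z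

/-- Subharmonicity on `s` via the sub-mean-value property. -/
def SubharmonicOn2 (w : ℂ → ℝ) (s : Set ℂ) : Prop :=
  ∀ z ∈ s, ∀ r : ℝ, 0 < r → Metric.closedBall z r ⊆ s → w z ≤ circleAvg w z r

/-- Non-tangential approach region in `B` at `x₀` with aperture `C`. -/
def NontangentialIn (B : Set ℂ) (x₀ : ℂ) (C : ℝ) : Set ℂ :=
  {x ∈ B | ‖x - x₀‖ ≤ C * Metric.infDist x Bᶜ}

/-- `w(x) = α ⟨x − x₀, ν⟩⁺ + o(|x − x₀|)` as `x → x₀` within the region `R`. -/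
def HasSlopeAt (w : ℂ → ℝ) (x₀ ν : ℂ) (α : ℝ) (R : Set ℂ) : Prop :=
  Filter.Tendsto (fun x => (w x - α * max (dot2 (x - x₀) ν) 0) / ‖x - x₀‖)
    (nhdsWithin x₀ R) (nhds 0)

/-- Viscosity supersolution of the one-phase free boundary problem in `Ω`. -/
structure ViscositySupersolution (Ω : Set ℂ) (w : ℂ → ℝ) : Prop where
  contOn : ContinuousOn w Ω
  nonneg : ∀ z ∈ Ω, 0 ≤ w z
  superharm : SuperharmonicOn2 w (posSet Ω w)
  slope : ∀ x₀ ∈ FB Ω w, ∀ (y : ℂ) (ρ : ℝ), 0 < ρ → Metric.ball y ρ ⊆ posSet Ω w →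
    dist x₀ y = ρ → ∃ α : ℝ, α ≤ 1 ∧ ∀ C : ℝ, 1 < C →
      HasSlopeAt w x₀ ((y - x₀) / (ρ : ℂ)) α (NontangentialIn (Metric.ball y ρ) x₀ C)

/-- Viscosity subsolution of the one-phase free boundary problem in `Ω`. -/
structure ViscositySubsolution (Ω : Set ℂ) (w : ℂ → ℝ) : Prop where
  contOn : ContinuousOn w Ω
  nonneg : ∀ z ∈ Ω, 0 ≤ w z
  subharm : SubharmonicOn2 w (posSet Ω w)
  slope : ∀ x₀ ∈ FB Ω w, ∀ (y : ℂ) (ρ : ℝ), 0 < ρ →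
    Metric.ball y ρ ⊆ {z ∈ Ω | w z = 0} → dist x₀ y = ρ →
    ∃ α : ℝ, 1 ≤ α ∧ ∀ C : ℝ, 1 < C →
      HasSlopeAt w x₀ ((x₀ - y) / (ρ : ℂ)) α
        (NontangentialIn (closure (Metric.ball y ρ))ᶜ x₀ C)

/-- Viscosity solution: both a supersolution and a subsolution. -/
def ViscositySolution (Ω : Set ℂ) (w : ℂ → ℝ) : Prop :=
  ViscositySupersolution Ω w ∧ ViscositySubsolution Ω w

/-- Non-degeneracy with constant `c`: linear growth away from the free boundary. -/
def Nondegenerate (Ω : Set ℂ) (w : ℂ → ℝ) (c : ℝ) : Prop :=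
  ∀ x ∈ FB Ω w, ∀ r : ℝ, 0 < r → Metric.ball x r ⊆ Ω → c * r ≤ sSup (w '' Metric.ball x r)

/-- The open annulus `{δ < |z| < R}`. -/
def ann (δ R : ℝ) : Set ℂ := {z : ℂ | δ < ‖z‖ ∧ ‖z‖ < R}

/-- Condition (A): the free boundary of `u` in the annulus `{δ < |z| < R}` consists of
exactly two connected components, each non-compact with closure meeting both boundary
circles. -/
def ConditionA (δ R : ℝ) (u : ℂ → ℝ) : Prop :=
  ∃ F₁ F₂ : Set ℂ,
    F₁.Nonempty ∧ F₂.Nonempty ∧ Disjoint F₁ F₂ ∧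
    F₁ ∪ F₂ = FB (ann δ R) u ∧
    (∀ z ∈ F₁, connectedComponentIn (FB (ann δ R) u) z = F₁) ∧
    (∀ z ∈ F₂, connectedComponentIn (FB (ann δ R) u) z = F₂) ∧
    ¬ IsCompact F₁ ∧ ¬ IsCompact F₂ ∧
    (closure F₁ ∩ Metric.sphere 0 δ).Nonempty ∧
    (closure F₁ ∩ Metric.sphere 0 R).Nonempty ∧
    (closure F₂ ∩ Metric.sphere 0 δ).Nonempty ∧
    (closure F₂ ∩ Metric.sphere 0 R).Nonempty

/-- `k` is the curvature of the set `S` at the point `p`, computed via an arc-length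
parametrization. -/
def IsCurvatureAt (S : Set ℂ) (p : ℂ) (k : ℝ) : Prop :=
  ∃ γ : ℝ → ℂ, ContDiff ℝ 2 γ ∧ γ 0 = p ∧ (∀ s : ℝ, ‖deriv γ s‖ = 1) ∧
    (∃ ε > 0, ∀ s ∈ Set.Ioo (-ε) ε, γ s ∈ S) ∧ ‖deriv (deriv γ) 0‖ = k

/-- A set has exactly two connected components. -/
def HasExactlyTwoComponents (S : Set ℂ) : Prop :=
  ∃ z₁ ∈ S, ∃ z₂ ∈ S, connectedComponentIn S z₁ ≠ connectedComponentIn S z₂ ∧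
    ∀ z ∈ S, connectedComponentIn S z = connectedComponentIn S z₁ ∨
      connectedComponentIn S z = connectedComponentIn S z₂

end

lemma posSet_isOpen {Ω : Set ℂ} {u : ℂ → ℝ} (hΩ : IsOpen Ω) (h : IsClassicalSolution Ω u) :
    IsOpen (posSet Ω u) := by
  have := h.contOn.isOpen_inter_preimage hΩ (isOpen_Ioi (a := (0:ℝ)))
  exact this

lemma FB_zero {Ω : Set ℂ} {u : ℂ → ℝ} (hΩ : IsOpen Ω) (h : IsClassicalSolution Ω u) {p : ℂ}
    (hp : p ∈ FB Ω u) : u p = 0 := by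
  have h1 : p ∉ posSet Ω u := by
    have := hp.2
    rw [(posSet_isOpen hΩ h).frontier_eq] at this
    exact this.2
  have h2 := h.nonneg p hp.1
  by_contra h3
  exact h1 ⟨hp.1, lt_of_le_of_ne h2 (Ne.symm h3)⟩

lemma exists_hol {Ω : Set ℂ} {u : ℂ → ℝ} (hΩ : IsOpen Ω) (h : IsClassicalSolution Ω u)
    {z : ℂ} {R : ℝ} (hb : ball z R ⊆ posSet Ω u) :
    ∃ F : ℂ → ℂ, AnalyticOnNhd ℂ F (ball z R) ∧ ∀ w ∈ ball z R, u w = (F w).re := by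
  have hop := posSet_isOpen hΩ h
  have hc : ∀ x ∈ posSet Ω u, ContDiffAt ℝ 2 u x := fun x hx =>
    (h.harm.1 x hx).contDiffAt (hop.mem_nhds hx)
  have hL : ∀ x ∈ posSet Ω u, Laplacian.laplacian u x = 0 := by
    intro x hx
    rw [InnerProductSpace.laplacian_eq_iteratedFDeriv_complexPlane]
    simp only [iteratedFDeriv_two_apply]
    have h2 := h.harm.2 x hx
    have hd : DifferentiableAt ℝ (fderiv ℝ u) x :=
      ((hc x hx).fderiv_right (m := 1) (by norm_num)).differentiableAt (by norm_num)
    have key : ∀ v : ℂ, hess u x v v = fderiv ℝ (fderiv ℝ u) x v v := by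
      intro v
      unfold hess
      rw [fderiv_clm_apply hd (differentiableAt_const v)]
      simp
    rw [key, key] at h2
    simpa using h2
  have hh : InnerProductSpace.HarmonicOnNhd u (ball z R) := by
    intro x hx
    refine ⟨hc x (hb hx), ?_⟩
    filter_upwards [hop.mem_nhds (hb hx)] with y hy using hL y hy
  obtain ⟨F, hF, hE⟩ := hh.exists_analyticOnNhd_ball_re_eq
  exact ⟨F, hF, fun w hw => (hE hw).symm⟩

lemma hasFDerivAt_re {F : ℂ → ℂ} {z : ℂ} (hF : DifferentiableAt ℂ F z) :
    HasFDerivAt (fun w => (F w).re)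
      (reCLM.comp ((ContinuousLinearMap.toSpanSingleton ℂ (deriv F z)).restrictScalars ℝ)) z := by
  have h1 := hF.hasDerivAt.hasFDerivAt.restrictScalars ℝ
  exact reCLM.hasFDerivAt.comp z h1

lemma fderiv_eq_re {u : ℂ → ℝ} {F : ℂ → ℂ} {z : ℂ} (hF : DifferentiableAt ℂ F z)
    (hu : u =ᶠ[𝓝 z] fun w => (F w).re) (v : ℂ) :
    fderiv ℝ u z v = (v * deriv F z).re := by
  rw [hu.fderiv_eq, (hasFDerivAt_re hF).fderiv]
  simp

lemma norm_grad2_eq {u : ℂ → ℝ} {F : ℂ → ℂ} {z : ℂ} (hF : DifferentiableAt ℂ F z)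
    (hu : u =ᶠ[𝓝 z] fun w => (F w).re) :
    ‖grad2 u z‖ = ‖deriv F z‖ := by
  unfold grad2
  rw [fderiv_eq_re hF hu, fderiv_eq_re hF hu, ← Complex.norm_conj (deriv F z)]
  congr 1
  apply Complex.ext <;> simp

lemma harnack {Ω : Set ℂ} {u : ℂ → ℝ} (hΩ : IsOpen Ω) (h : IsClassicalSolution Ω u)
    {x y : ℂ} {d : ℝ} (hb : ball x d ⊆ posSet Ω u) (hy : y ∈ ball x d) :
    u x * (d - dist y x) ≤ u y * (d + dist y x) := by
  obtain ⟨F, hF, hE⟩ := exists_hol hΩ h hb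
  have hd : 0 < d := pos_of_mem_ball hy
  have hx : x ∈ ball x d := mem_ball_self hd
  have hpos : ∀ w ∈ ball x d, 0 < (F w).re := fun w hw => by
    rw [← hE w hw]; exact (hb hw).2
  have hden : ∀ w ∈ ball x d, F w + (starRingEnd ℂ) (F x) ≠ 0 := by
    intro w hw h0
    have := congrArg Complex.re h0
    simp at this
    linarith [hpos w hw, hpos x hx]
  set g : ℂ → ℂ := fun w => (F w - F x) / (F w + (starRingEnd ℂ) (F x)) with hg
  have hgd : DifferentiableOn ℂ g (ball x d) := by
    apply DifferentiableOn.div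
    · exact hF.differentiableOn.sub_const _
    · exact hF.differentiableOn.add_const _
    · exact hden
  have gx : g x = 0 := by simp [hg]
  have hm : MapsTo g (ball x d) (closedBall (g x) 1) := by
    intro w hw
    rw [gx, mem_closedBall_zero_iff, hg]
    simp only [norm_div]
    rw [div_le_one (norm_pos_iff.2 (hden w hw))]
    apply (sq_le_sq₀ (norm_nonneg _) (norm_nonneg _)).1
    rw [← Complex.normSq_eq_norm_sq, ← Complex.normSq_eq_norm_sq]
    simp only [Complex.normSq_apply, sub_re, sub_im, add_re, add_im, conj_re, conj_im]
    nlinarith [mul_pos (hpos w hw) (hpos x hx)]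
  have hs := Complex.dist_le_div_mul_dist_of_mapsTo_ball hgd hm hy
  rw [gx, dist_zero_right, hg] at hs
  simp only [norm_div] at hs
  rw [div_le_iff₀ (norm_pos_iff.2 (hden y hy))] at hs
  have hs2 : d * ‖F y - F x‖ ≤ dist y x * ‖F y + (starRingEnd ℂ) (F x)‖ := by
    calc d * ‖F y - F x‖ ≤ d * (1 / d * dist y x * ‖F y + (starRingEnd ℂ) (F x)‖) := by gcongr
      _ = _ := by field_simp
  have hρ : 0 ≤ dist y x := dist_nonneg
  have hρd : dist y x < d := hy
  set ρ := dist y x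
  have hs3 : (d * ‖F y - F x‖)^2 ≤ (ρ * ‖F y + (starRingEnd ℂ) (F x)‖)^2 := by gcongr
  rw [mul_pow, mul_pow, ← Complex.normSq_eq_norm_sq, ← Complex.normSq_eq_norm_sq] at hs3
  simp only [Complex.normSq_apply, sub_re, sub_im, add_re, add_im, conj_re, conj_im] at hs3
  rw [hE x hx, hE y hy]
  have ha := hpos x hx
  have hbb := hpos y hy
  set a := (F x).re
  set b := (F y).re
  set q := (F y).im - (F x).im with hq
  have hq' : (F y).im + -(F x).im = q := by rw [hq]; ring
  rw [hq'] at hs3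
  have hs4 : (d * (a - b))^2 ≤ (ρ * (a + b))^2 := by
    have : ρ^2 * (q*q) ≤ d^2 * (q*q) := by
      apply mul_le_mul_of_nonneg_right _ (mul_self_nonneg q)
      gcongr
    nlinarith
  have hs5 : d * (a - b) ≤ ρ * (a + b) := abs_le_of_sq_le_sq' hs4 (by positivity) |>.2
  nlinarith

lemma hopf {Ω : Set ℂ} {u : ℂ → ℝ} (hΩ : IsOpen Ω) (h : IsClassicalSolution Ω u)
    {x p : ℂ} {d : ℝ} (hd : 0 < d) (hb : ball x d ⊆ posSet Ω u) (hp : p ∈ FB Ω u)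
    (hxp : dist p x = d) : u x ≤ 4 * d := by
  have hgr := h.grad_one p hp
  have hev : ∀ᶠ w in 𝓝[posSet Ω u] p, ‖grad2 u w‖ < 2 := hgr.eventually (gt_mem_nhds (by norm_num))
  obtain ⟨ε, hε, hball⟩ := Metric.mem_nhdsWithin_iff.1 hev
  set γ : ℝ → ℂ := fun s => p + s * (x - p) with hγ
  have hnx : ‖x - p‖ = d := by rw [← hxp, dist_comm, dist_eq_norm]
  have hγb : ∀ s ∈ Ioo (0:ℝ) 1, dist (γ s) x = (1 - s) * d := by
    intro s hs
    have : γ s - x = ((s - 1 : ℝ) : ℂ) * (x - p) := by simp [hγ]; ring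
    rw [dist_eq_norm, this, norm_mul, hnx, Complex.norm_real, Real.norm_eq_abs,
      abs_of_neg (by linarith [hs.2])]
    ring
  have hγp : ∀ s ∈ Ioo (0:ℝ) 1, γ s ∈ ball x d := by
    intro s hs
    rw [mem_ball, hγb s hs]
    nlinarith [hs.1]
  set s0 : ℝ := min (1/2) (ε / (2 * d)) with hs0
  have hs0p : 0 < s0 := by positivity
  have hs01 : s0 < 1 := lt_of_le_of_lt (min_le_left _ _) (by norm_num)
  have hs0e : s0 * d < ε := by
    have : s0 * d ≤ ε / (2 * d) * d := by gcongr; exact min_le_right _ _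
    have h2 : ε / (2 * d) * d = ε / 2 := by field_simp
    linarith
  have hder : ∀ s ∈ Ioo (0:ℝ) s0, HasDerivAt (fun s => u (γ s)) (fderiv ℝ u (γ s) (x - p)) s := by
    intro s hs
    have hin := hb (hγp s ⟨hs.1, hs.2.trans hs01⟩)
    have hdf : DifferentiableAt ℝ u (γ s) :=
      ((h.harm.1 _ hin).contDiffAt ((posSet_isOpen hΩ h).mem_nhds hin)).differentiableAt (by norm_num)
    have hγd : HasDerivAt γ (x - p) s := by
      have := ((Complex.ofRealCLM.hasDerivAt (x := s)).mul_const (x - p)).const_add p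
      simpa [hγ] using this
    exact hdf.hasFDerivAt.comp_hasDerivAt s hγd
  have hbd : ∀ s ∈ Ioo (0:ℝ) s0, fderiv ℝ u (γ s) (x - p) ≤ 2 * d := by
    intro s hs
    have hsin := hγp s ⟨hs.1, hs.2.trans hs01⟩
    obtain ⟨F, hF, hE⟩ := exists_hol hΩ h hb
    have hev : u =ᶠ[𝓝 (γ s)] fun w => (F w).re := by
      filter_upwards [isOpen_ball.mem_nhds hsin] with w hw using hE w hw
    have hFd := (hF _ hsin).differentiableAt
    have h1 := norm_grad2_eq hFd hev
    have h2 : ‖grad2 u (γ s)‖ < 2 := by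
      apply hball
      refine ⟨?_, hb hsin⟩
      rw [mem_ball, dist_eq_norm]
      have : γ s - p = (s:ℂ) * (x - p) := by simp [hγ]
      rw [this, norm_mul, hnx, Complex.norm_real, Real.norm_eq_abs, abs_of_pos hs.1]
      nlinarith [hs.2]
    rw [fderiv_eq_re hFd hev]
    refine (Complex.re_le_norm _).trans ?_
    rw [norm_mul, hnx, ← h1]
    nlinarith
  have hcont : ContinuousOn (fun s => u (γ s)) (Icc 0 (s0/2)) := by
    apply h.contOn.comp
    · apply Continuous.continuousOn
      fun_prop
    · intro s hs
      rcases eq_or_lt_of_le hs.1 with h0 | h0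
      · rw [← h0]; simpa [hγ] using hp.1
      · exact (hb (hγp s ⟨h0, by linarith [hs.2]⟩)).1
  have hmv := exists_hasDerivAt_eq_slope (fun s => u (γ s)) (fun s => fderiv ℝ u (γ s) (x - p))
    (a := 0) (b := s0/2) (by positivity) hcont
    (fun s hs => hder s ⟨hs.1, by linarith [hs.2]⟩)
  obtain ⟨c, hc, hceq⟩ := hmv
  have hle := hbd c ⟨hc.1, by linarith [hc.2]⟩
  have hu0 : u (γ 0) = 0 := by simpa [hγ] using FB_zero hΩ h hp
  rw [hceq, hu0, sub_zero, sub_zero, div_le_iff₀ (by positivity)] at hle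
  have hmem : s0/2 ∈ Ioo (0:ℝ) 1 := ⟨by positivity, by linarith⟩
  have hhar := harnack hΩ h hb (hγp (s0/2) hmem)
  rw [hγb _ hmem] at hhar
  have hup : 0 ≤ u (γ (s0/2)) := h.nonneg _ (hb (hγp _ hmem)).1
  have h1 : u x * (s0/2 * d) ≤ u (γ (s0/2)) * (2 * d) := by
    calc u x * (s0/2 * d) = u x * (d - (1 - s0/2)*d) := by ring
      _ ≤ _ := hhar
      _ ≤ _ := by apply mul_le_mul_of_nonneg_left _ hup; nlinarith
  have h2 : u x * (s0/2 * d) ≤ 4 * d * (s0/2 * d) := by nlinarith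
  exact le_of_mul_le_mul_right h2 (by positivity)

lemma exists_beta {ε : ℝ} (hε : 0 < ε) : ∃ b b1 b2 : ℝ → ℝ,
    (∀ s, HasDerivAt b (b1 s) s) ∧ (∀ s, HasDerivAt b1 (b2 s) s) ∧ Continuous b2 ∧
    (∀ s, 0 ≤ b2 s) ∧ (∀ s < ε / 2, b s = 0 ∧ b1 s = 0 ∧ b2 s = 0) ∧
    (∀ s ≥ ε, b1 s = 1) ∧ (∀ s > ε, b2 s = 0) ∧ (∀ s ≥ 0, b s ≤ s ∧ s - ε ≤ b s) := by
  set b1 : ℝ → ℝ := fun s => Real.smoothTransition (2 * s / ε - 1) with hb1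
  have hsm : ContDiff ℝ 1 b1 := by
    have := Real.smoothTransition.contDiff (n := 1)
    apply ContDiff.comp (this)
    fun_prop
  have hcont : Continuous b1 := hsm.continuous
  have hz : ∀ s < ε / 2, b1 s = 0 := by
    intro s hs
    apply Real.smoothTransition.zero_of_nonpos
    have : 2 * s / ε ≤ 1 := by rw [div_le_one hε]; linarith
    linarith
  have ho : ∀ s ≥ ε, b1 s = 1 := by
    intro s hs
    apply Real.smoothTransition.one_of_one_le
    have : 2 ≤ 2 * s / ε := by rw [le_div_iff₀ hε]; linarith
    linarith
  have hmono : Monotone b1 := by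
    intro x y hxy
    apply Real.smoothTransition.monotone
    gcongr
  have hd1 : ∀ s, HasDerivAt b1 (deriv b1 s) s := fun s =>
    (hsm.differentiable (by norm_num) s).hasDerivAt
  have hn : ∀ s, 0 ≤ b1 s := fun s => Real.smoothTransition.nonneg _
  have hl : ∀ s, b1 s ≤ 1 := fun s => Real.smoothTransition.le_one _
  have hii : ∀ x y, IntervalIntegrable b1 volume x y := fun x y => hcont.intervalIntegrable x y
  refine ⟨fun s => ∫ x in (0:ℝ)..s, b1 x, b1, deriv b1, ?_, hd1, hsm.continuous_deriv (by norm_num),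
    fun s => hmono.deriv_nonneg, ?_, ho, ?_, ?_⟩
  · intro s
    exact intervalIntegral.integral_hasDerivAt_right (hii _ _)
      (hcont.stronglyMeasurableAtFilter _ _) hcont.continuousAt
  · intro s hs
    refine ⟨?_, hz s hs, ?_⟩
    · show (∫ x in (0:ℝ)..s, b1 x) = 0
      rw [intervalIntegral.integral_congr (g := fun _ => (0:ℝ))]
      · simp
      · intro x hx
        apply hz
        rcases le_total 0 s with h | h
        · rw [uIcc_of_le h] at hx; linarith [hx.2]
        · rw [uIcc_of_ge h] at hx; linarith [hx.2]
    · have : b1 =ᶠ[𝓝 s] fun _ => (0:ℝ) := by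
        filter_upwards [gt_mem_nhds hs] with x hx using hz x hx
      rw [this.deriv_eq]; simp
  · intro s hs
    have : b1 =ᶠ[𝓝 s] fun _ => (1:ℝ) := by
      filter_upwards [lt_mem_nhds hs] with x hx using ho x hx.le
    rw [this.deriv_eq]; simp
  · intro s hs
    constructor
    · calc (∫ x in (0:ℝ)..s, b1 x) ≤ ∫ x in (0:ℝ)..s, (1:ℝ) :=
            intervalIntegral.integral_mono_on hs (hii _ _) (by simp) (fun x _ => hl x)
        _ = s := by simp
    · rcases le_total s ε with h | h
      · have : 0 ≤ ∫ x in (0:ℝ)..s, b1 x := intervalIntegral.integral_nonneg hs (fun x _ => hn x)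
        simp only
        linarith
      · have h1 : 0 ≤ ∫ x in (0:ℝ)..ε, b1 x := intervalIntegral.integral_nonneg hε.le (fun x _ => hn x)
        have h2 : ∫ x in ε..s, b1 x = s - ε := by
          rw [intervalIntegral.integral_congr (g := fun _ => (1:ℝ))]
          · simp
          · intro x hx
            rw [uIcc_of_le h] at hx
            exact ho x hx.1
        have h3 := intervalIntegral.integral_add_adjacent_intervals (hii 0 ε) (hii ε s)
        simp only
        linarith

lemma strip_isOpen (t1 t2 : ℝ) : IsOpen {z : ℂ | z.re ∈ Ioo t1 t2} :=
  isOpen_Ioo.preimage Complex.continuous_re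

lemma deriv_param {G : ℂ → ℝ} {t1 t2 : ℝ} (hG : ContDiffOn ℝ 1 G {z : ℂ | z.re ∈ Ioo t1 t2})
    {t : ℝ} (ht : t ∈ Ioo t1 t2) :
    HasDerivAt (fun t : ℝ => ∫ θ in (0:ℝ)..(2 * Real.pi), G (t + θ * I))
      (∫ θ in (0:ℝ)..(2 * Real.pi), fderiv ℝ G (t + θ * I) 1) t := by
  have hop := strip_isOpen t1 t2
  have hmem : ∀ (s θ : ℝ), s ∈ Ioo t1 t2 → (s + θ * I : ℂ) ∈ {z : ℂ | z.re ∈ Ioo t1 t2} := by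
    intro s θ hs; simpa using hs
  have hcf : ContinuousOn (fun z => fderiv ℝ G z 1) {z : ℂ | z.re ∈ Ioo t1 t2} :=
    (hG.continuousOn_fderiv_of_isOpen hop (by norm_num)).clm_apply continuousOn_const
  have hline : ∀ s : ℝ, Continuous (fun θ : ℝ => (s + θ * I : ℂ)) := by intro s; fun_prop
  have hc1 : ∀ s ∈ Ioo t1 t2, Continuous (fun θ : ℝ => G (s + θ * I)) := by
    intro s hs
    exact hG.continuousOn.comp_continuous (hline s) (fun θ => hmem s θ hs)
  have hc2 : ∀ s ∈ Ioo t1 t2, Continuous (fun θ : ℝ => fderiv ℝ G (s + θ * I) 1) := by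
    intro s hs
    exact hcf.comp_continuous (hline s) (fun θ => hmem s θ hs)
  obtain ⟨l, r, hlr, hnb, hsub⟩ : ∃ l r : ℝ, t ∈ Ioo l r ∧ Icc l r ∈ 𝓝 t ∧ Icc l r ⊆ Ioo t1 t2 := by
    refine ⟨(t1+t)/2, (t+t2)/2, ⟨by linarith [ht.1], by linarith [ht.2]⟩,
      Icc_mem_nhds (by linarith [ht.1]) (by linarith [ht.2]), ?_⟩
    intro x hx
    exact ⟨by linarith [ht.1, hx.1], by linarith [ht.2, hx.2]⟩
  have hK : IsCompact ((fun q : ℝ × ℝ => (q.1 + q.2 * I : ℂ)) '' (Icc l r ×ˢ Icc 0 (2 * Real.pi))) := by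
    apply (isCompact_Icc.prod isCompact_Icc).image
    fun_prop
  obtain ⟨C, hC⟩ := hK.exists_bound_of_continuousOn (hcf.mono (by
    rintro _ ⟨q, hq, rfl⟩
    exact hmem _ _ (hsub hq.1)))
  have := intervalIntegral.hasDerivAt_integral_of_dominated_loc_of_deriv_le
    (μ := volume) (a := 0) (b := 2 * Real.pi) (F := fun (t:ℝ) (θ:ℝ) => G (t + θ * I))
    (F' := fun (t:ℝ) (θ:ℝ) => fderiv ℝ G (t + θ * I) 1) (x₀ := t) (s := Icc l r)
    (bound := fun _ => C) hnb ?_ ?_ ?_ ?_ ?_ ?_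
  · exact this.2
  · filter_upwards [hnb] with s hs
    exact (hc1 s (hsub hs)).aestronglyMeasurable
  · exact (hc1 t ht).intervalIntegrable _ _
  · exact (hc2 t ht).aestronglyMeasurable
  · refine Eventually.of_forall (fun θ hθ s hs => hC _ ⟨(s, θ), ⟨hs, ?_⟩, rfl⟩)
    rw [uIoc_of_le (by positivity)] at hθ
    exact ⟨hθ.1.le, hθ.2⟩
  · simp
  · refine Eventually.of_forall (fun θ hθ s hs => ?_)
    have hin := hmem s θ (hsub hs)
    have hd : DifferentiableAt ℝ G (s + θ * I) :=
      ((hG _ hin).contDiffAt (hop.mem_nhds hin)).differentiableAt (by norm_num)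
    have hγ : HasDerivAt (fun s : ℝ => (s + θ * I : ℂ)) 1 s := by
      simpa using (Complex.ofRealCLM.hasDerivAt (x := s)).add_const (θ * I)
    exact hd.hasFDerivAt.comp_hasDerivAt s hγ

lemma convex_param {W : ℂ → ℝ} {t1 t2 κ : ℝ} (hW : ContDiffOn ℝ 2 W {z : ℂ | z.re ∈ Ioo t1 t2})
    (hper : ∀ z, W (z + 2 * Real.pi * I) = W z)
    (hlap' : ∀ t ∈ Ioo t1 t2, ∃ k : ℝ → ℝ, Continuous k ∧
      (∀ θ : ℝ, k θ ≤ hess W (t + θ * I) 1 1 + hess W (t + θ * I) I I) ∧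
      κ * Real.exp t ≤ ∫ θ in (0:ℝ)..(2 * Real.pi), k θ) :
    ConvexOn ℝ (Ioo t1 t2) (fun t : ℝ =>
      (∫ θ in (0:ℝ)..(2 * Real.pi), W (t + θ * I)) - κ * Real.exp t) := by
  have hop := strip_isOpen t1 t2
  have hfd : ContDiffOn ℝ 1 (fderiv ℝ W) {z : ℂ | z.re ∈ Ioo t1 t2} :=
    hW.fderiv_of_isOpen hop (by norm_num)
  have hfv : ∀ v : ℂ, ContDiffOn ℝ 1 (fun z => fderiv ℝ W z v) {z : ℂ | z.re ∈ Ioo t1 t2} :=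
    fun v => hfd.clm_apply contDiffOn_const
  have hD1 : ∀ t ∈ Ioo t1 t2, HasDerivAt _ _ t := fun t ht => deriv_param (hW.of_le (by norm_num)) ht
  have hD2 : ∀ t ∈ Ioo t1 t2, HasDerivAt _ _ t := fun t ht => deriv_param (hfv 1) ht
  have hline : ∀ s : ℝ, Continuous (fun θ : ℝ => (s + θ * I : ℂ)) := by intro s; fun_prop
  have hmem : ∀ (s θ : ℝ), s ∈ Ioo t1 t2 → (s + θ * I : ℂ) ∈ {z : ℂ | z.re ∈ Ioo t1 t2} := by
    intro s θ hs; simpa using hs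
  have hch : ∀ v w : ℂ, ∀ t ∈ Ioo t1 t2, Continuous (fun θ : ℝ => hess W (t + θ * I) v w) := by
    intro v w t ht
    have : ContinuousOn (fun z => hess W z v w) {z : ℂ | z.re ∈ Ioo t1 t2} :=
      ((hfv v).continuousOn_fderiv_of_isOpen hop (by norm_num)).clm_apply continuousOn_const
    exact this.comp_continuous (hline t) (fun θ => hmem t θ ht)
  have hperI : ∀ t ∈ Ioo t1 t2, ∫ θ in (0:ℝ)..(2 * Real.pi), hess W (t + θ * I) I I = 0 := by
    intro t ht
    have hd : ∀ θ ∈ uIcc (0:ℝ) (2 * Real.pi), HasDerivAt (fun θ : ℝ => fderiv ℝ W (t + θ * I) I)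
        (hess W (t + θ * I) I I) θ := by
      intro θ _
      have hin := hmem t θ ht
      have hd : DifferentiableAt ℝ (fun z => fderiv ℝ W z I) (t + θ * I) :=
        ((hfv I _ hin).contDiffAt (hop.mem_nhds hin)).differentiableAt (by norm_num)
      have hγ : HasDerivAt (fun s : ℝ => (t + s * I : ℂ)) I θ := by
        simpa using ((Complex.ofRealCLM.hasDerivAt (x := θ)).mul_const I).const_add (t : ℂ)
      exact hd.hasFDerivAt.comp_hasDerivAt θ hγ
    rw [intervalIntegral.integral_eq_sub_of_hasDerivAt hd ((hch I I t ht).intervalIntegrable _ _)]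
    have : fderiv ℝ W (t + 2 * Real.pi * I) = fderiv ℝ W t := by
      rw [← fderiv_comp_add_right]
      congr 1
      funext z; exact hper z
    push_cast
    rw [this]
    simp
  have hlap : ∀ t ∈ Ioo t1 t2, κ * Real.exp t ≤
      ∫ θ in (0:ℝ)..(2 * Real.pi), (hess W (t + θ * I) 1 1 + hess W (t + θ * I) I I) := by
    intro t ht
    obtain ⟨k, hk, hk1, hk2⟩ := hlap' t ht
    refine hk2.trans (intervalIntegral.integral_mono_on (by positivity) (hk.intervalIntegrable _ _)
      (((hch 1 1 t ht).add (hch I I t ht)).intervalIntegrable _ _) (fun θ _ => hk1 θ))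
  apply convexOn_of_deriv2_nonneg' (convex_Ioo _ _)
  · intro t ht
    exact ((hD1 t ht).sub ((Real.hasDerivAt_exp t).const_mul κ)).differentiableAt.differentiableWithinAt
  · have heq : EqOn (deriv (fun t : ℝ =>
      (∫ θ in (0:ℝ)..(2 * Real.pi), W (t + θ * I)) - κ * Real.exp t))
      (fun t => (∫ θ in (0:ℝ)..(2 * Real.pi), fderiv ℝ W (t + θ * I) 1) - κ * Real.exp t) (Ioo t1 t2) :=
      fun t ht => ((hD1 t ht).sub ((Real.hasDerivAt_exp t).const_mul κ)).deriv
    intro t ht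
    exact (((hD2 t ht).sub ((Real.hasDerivAt_exp t).const_mul κ)).differentiableAt.differentiableWithinAt).congr
      heq (heq ht)
  · intro t ht
    have heq : (deriv (fun t : ℝ =>
      (∫ θ in (0:ℝ)..(2 * Real.pi), W (t + θ * I)) - κ * Real.exp t)) =ᶠ[𝓝 t]
      (fun t => (∫ θ in (0:ℝ)..(2 * Real.pi), fderiv ℝ W (t + θ * I) 1) - κ * Real.exp t) := by
      filter_upwards [isOpen_Ioo.mem_nhds ht] with t ht
      exact ((hD1 t ht).sub ((Real.hasDerivAt_exp t).const_mul κ)).deriv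
    simp only [Function.iterate_succ, Function.iterate_zero, Function.comp, id]
    rw [heq.deriv_eq, ((hD2 t ht).fun_sub ((Real.hasDerivAt_exp t).const_mul κ)).deriv]
    have h1 := hlap t ht
    rw [intervalIntegral.integral_add ((hch 1 1 t ht).intervalIntegrable _ _)
      ((hch I I t ht).intervalIntegrable _ _), hperI t ht] at h1
    unfold hess at h1
    linarith

lemma lap_comp {b b1 b2 : ℝ → ℝ} (hb : ∀ s, HasDerivAt b (b1 s) s)
    (hb1 : ∀ s, HasDerivAt b1 (b2 s) s) (hb2 : Continuous b2) {W : ℂ → ℝ} {F : ℂ → ℂ} {z : ℂ}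
    (hF : AnalyticAt ℂ F z) (hW : W =ᶠ[𝓝 z] fun w => b (F w).re) :
    ContDiffAt ℝ 2 W z ∧ hess W z 1 1 + hess W z I I = b2 (F z).re * ‖deriv F z‖ ^ 2 := by
  have hbC : ContDiff ℝ 2 b := by
    have e1 : deriv b = b1 := funext fun s => (hb s).deriv
    have e2 : deriv b1 = b2 := funext fun s => (hb1 s).deriv
    have : ContDiff ℝ 1 b1 := by
      rw [contDiff_one_iff_deriv]
      exact ⟨fun s => (hb1 s).differentiableAt, by rw [e2]; exact hb2⟩
    have h2 : ContDiff ℝ (1 + 1) b := by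
      rw [contDiff_succ_iff_deriv]
      refine ⟨fun s => (hb s).differentiableAt, by simp, by rw [e1]; exact this⟩
    simpa [one_add_one_eq_two] using h2
  constructor
  · have h1 : ContDiffAt ℝ 2 F z := (hF.contDiffAt (n := 2)).restrict_scalars ℝ
    have h2 : ContDiffAt ℝ 2 (fun w => b (F w).re) z :=
      hbC.contDiffAt.comp z (reCLM.contDiff.contDiffAt.comp z h1)
    exact h2.congr_of_eventuallyEq hW
  · have hFe : ∀ᶠ w in 𝓝 z, AnalyticAt ℂ F w := hF.eventually_analyticAt
    have hfd : ∀ v : ℂ, (fun w => fderiv ℝ W w v) =ᶠ[𝓝 z] fun w => b1 (F w).re * (v * deriv F w).re := by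
      intro v
      filter_upwards [hFe, hW.eventuallyEq_nhds] with w hw hWw
      rw [hWw.fderiv_eq]
      have := (hb (F w).re).comp_hasFDerivAt w (hasFDerivAt_re hw.differentiableAt)
      have h3 := this.fderiv
      simp only [Function.comp_def] at h3
      rw [h3]
      simp
    have hh : ∀ v : ℂ, hess W z v v =
        b1 (F z).re * (v * (v * deriv (deriv F) z)).re + b2 (F z).re * (v * deriv F z).re ^ 2 := by
      intro v
      unfold hess
      rw [(hfd v).fderiv_eq]
      have h1 := (hb1 (F z).re).comp_hasFDerivAt z (hasFDerivAt_re hF.differentiableAt)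
      have h2 : HasFDerivAt (fun w => (v * deriv F w).re) _ z :=
        hasFDerivAt_re (F := fun w => v * deriv F w) (hF.deriv.differentiableAt.const_mul v)
      have h3 := (h1.mul h2).fderiv
      have h4 : deriv (fun w => v * deriv F w) z = v * deriv (deriv F) z :=
        deriv_const_mul _ hF.deriv.differentiableAt
      have h5 : fderiv ℝ (fun w => b1 (F w).re * (v * deriv F w).re) z = _ := h3
      rw [h5]
      simp [h4]
      ring
    rw [hh, hh, ← Complex.normSq_eq_norm_sq, Complex.normSq_apply]
    simp
    ring

lemma grad_lower {Ω : Set ℂ} {u : ℂ → ℝ} (hΩ : IsOpen Ω) (h : IsClassicalSolution Ω u)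
    {K : Set ℂ} (hK : IsCompact K) (hKΩ : K ⊆ Ω) :
    ∃ ε > 0, ∀ z ∈ K, 0 < u z → u z < ε → 1 / 2 ≤ ‖grad2 u z‖ := by
  by_contra! hcon
  have hc : ∀ n : ℕ, ∃ z ∈ K, 0 < u z ∧ u z < 1 / ((n:ℝ) + 1) ∧ ‖grad2 u z‖ < 1 / 2 := by
    intro n
    obtain ⟨z, h1, h2, h3, h4⟩ := hcon (1 / ((n:ℝ) + 1)) (by positivity)
    exact ⟨z, h1, h2, h3, h4⟩
  choose z hzK hz0 hz1 hz2 using hc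
  obtain ⟨x, hx, φ, hφ, hlim⟩ := hK.tendsto_subseq hzK
  have hxΩ := hKΩ hx
  have hux : Tendsto (fun n => u (z (φ n))) atTop (𝓝 (u x)) :=
    ((h.contOn.continuousAt (hΩ.mem_nhds hxΩ)).tendsto.comp hlim)
  have hu0 : Tendsto (fun n => u (z (φ n))) atTop (𝓝 0) := by
    apply squeeze_zero (fun n => (hz0 _).le) (fun n => (hz1 _).le)
    exact tendsto_one_div_add_atTop_nhds_zero_nat.comp hφ.tendsto_atTop
  have hux0 : u x = 0 := tendsto_nhds_unique hux hu0
  have hpos : ∀ n, z (φ n) ∈ posSet Ω u := fun n => ⟨hKΩ (hzK _), hz0 _⟩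
  have hFB : x ∈ FB Ω u := by
    refine ⟨hxΩ, ?_⟩
    rw [(posSet_isOpen hΩ h).frontier_eq]
    refine ⟨mem_closure_of_tendsto hlim (Eventually.of_forall hpos), fun hh => ?_⟩
    exact absurd hux0 hh.2.ne'
  have hg := h.grad_one x hFB
  have h1 : Tendsto (fun n => z (φ n)) atTop (𝓝[posSet Ω u] x) :=
    tendsto_nhdsWithin_iff.2 ⟨hlim, Eventually.of_forall hpos⟩
  have h2 := hg.comp h1
  have h3 : (1:ℝ) ≤ 1 / 2 := le_of_tendsto h2 (Eventually.of_forall fun n => (hz2 _).le)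
  norm_num at h3

lemma max_lower {Ω : Set ℂ} {u : ℂ → ℝ} (hΩ : IsOpen Ω) (hu : ContinuousOn u Ω)
    {a : ℂ} {R1 R2 : ℝ} (hR1 : 0 < R1)
    (hK : ∀ z, R1 ≤ ‖z - a‖ → ‖z - a‖ ≤ R2 → z ∈ Ω)
    (hp : ∀ r ∈ Icc R1 R2, ∃ z ∈ sphere a r, 0 < u z) :
    ∃ ε > 0, ∀ r ∈ Icc R1 R2, ∃ z ∈ sphere a r, ε ≤ u z := by
  by_contra! hcon
  have hc : ∀ n : ℕ, ∃ r ∈ Icc R1 R2, ∀ z ∈ sphere a r, u z < 1 / ((n:ℝ) + 1) :=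
    fun n => hcon (1 / ((n:ℝ) + 1)) (by positivity)
  choose r hr hru using hc
  obtain ⟨ρ, hρ, φ, hφ, hlim⟩ := isCompact_Icc.tendsto_subseq hr
  obtain ⟨z, hz, hzp⟩ := hp ρ hρ
  have hρ0 : 0 < ρ := hR1.trans_le hρ.1
  rw [mem_sphere, dist_eq_norm] at hz
  have hzΩ : z ∈ Ω := hK z (by rw [hz]; exact hρ.1) (by rw [hz]; exact hρ.2)
  have hlim2 : Tendsto (fun n => a + ((r (φ n) / ρ : ℝ) : ℂ) * (z - a)) atTop (𝓝 z) := by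
    have h1 : Tendsto (fun n => r (φ n) / ρ) atTop (𝓝 (ρ / ρ)) := hlim.div_const ρ
    rw [div_self hρ0.ne'] at h1
    have h2 := ((Complex.continuous_ofReal.tendsto 1).comp h1).mul_const (z - a) |>.const_add a
    simpa [Function.comp_def] using h2
  have hux := (hu.continuousAt (hΩ.mem_nhds hzΩ)).tendsto.comp hlim2
  have h0 : Tendsto (fun n => 1 / (((φ n : ℕ):ℝ) + 1)) atTop (𝓝 0) :=
    tendsto_one_div_add_atTop_nhds_zero_nat.comp hφ.tendsto_atTop
  have : u z ≤ 0 := by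
    refine le_of_tendsto_of_tendsto hux h0 (Eventually.of_forall fun n => ?_)
    refine (hru (φ n) _ ?_).le
    rw [mem_sphere, dist_eq_norm]
    simp only [add_sub_cancel_left, norm_mul, hz, Complex.norm_real, Real.norm_eq_abs]
    rw [abs_of_pos (div_pos (hR1.trans_le (hr _).1) hρ0)]
    field_simp
  linarith

lemma exists_polar {a z : ℂ} {r : ℝ} (hr : 0 < r) (hz : z ∈ sphere a r) :
    ∃ θ ∈ Icc (0:ℝ) (2 * Real.pi), z = a + Complex.exp ((Real.log r : ℝ) + θ * I) := by
  rw [mem_sphere, dist_eq_norm] at hz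
  have h1 : z - a = (r : ℂ) * Complex.exp (arg (z - a) * I) := by
    rw [← hz]; exact (Complex.norm_mul_exp_arg_mul_I _).symm
  have h2 : (r : ℂ) = Complex.exp ((Real.log r : ℝ)) := by
    rw [← Complex.ofReal_exp, Real.exp_log hr]
  rcases le_or_gt 0 (arg (z - a)) with h | h
  · refine ⟨arg (z - a), ⟨h, by linarith [Complex.arg_le_pi (z - a), Real.pi_pos]⟩, ?_⟩
    rw [Complex.exp_add, ← h2, ← h1]; ring
  · refine ⟨arg (z - a) + 2 * Real.pi, ⟨by linarith [Complex.neg_pi_lt_arg (z - a), Real.pi_pos], by linarith⟩, ?_⟩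
    rw [Complex.exp_add, ← h2]
    push_cast
    rw [add_mul, Complex.exp_add, Complex.exp_two_pi_mul_I, mul_one, ← h1]; ring

lemma norm_exp_polar (t θ : ℝ) : ‖Complex.exp (t + θ * I)‖ = Real.exp t := by
  rw [Complex.norm_exp]; simp

lemma mean_convex_eps {Ω : Set ℂ} {u : ℂ → ℝ} (hΩ : IsOpen Ω) (h : IsClassicalSolution Ω u)
    {a : ℂ} {R1 R2 : ℝ} (hR1 : 0 < R1) (hR2 : 0 < R2)
    (hK : ∀ z, R1 ≤ ‖z - a‖ → ‖z - a‖ ≤ R2 → z ∈ Ω)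
    (hz : ∀ r ∈ Icc R1 R2, ∃ z ∈ sphere a r, u z = 0)
    {ε : ℝ} (hε : 0 < ε)
    (hp : ∀ r ∈ Icc R1 R2, ∃ z ∈ sphere a r, ε ≤ u z)
    (hg : ∀ z, R1 ≤ ‖z - a‖ → ‖z - a‖ ≤ R2 → 0 < u z → u z < 2 * ε → 1 / 2 ≤ ‖grad2 u z‖)
    {b b1 b2 : ℝ → ℝ} (hb : ∀ s, HasDerivAt b (b1 s) s) (hb1 : ∀ s, HasDerivAt b1 (b2 s) s)
    (hb2c : Continuous b2) (hb2 : ∀ s, 0 ≤ b2 s)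
    (hbz : ∀ s < ε / 2, b s = 0 ∧ b1 s = 0 ∧ b2 s = 0) (hbo : ∀ s ≥ ε, b1 s = 1)
    (hbo2 : ∀ s > ε, b2 s = 0) :
    ConvexOn ℝ (Ioo (Real.log R1) (Real.log R2)) (fun t : ℝ =>
      (∫ θ in (0:ℝ)..(2 * Real.pi), b (u (a + Complex.exp (t + θ * I)))) - 1 / 2 * Real.exp t) := by
  have hexp : ∀ t ∈ Ioo (Real.log R1) (Real.log R2), R1 ≤ Real.exp t ∧ Real.exp t ≤ R2 := by
    intro t ht
    have h1 : R1 < Real.exp t := by rw [← Real.log_lt_iff_lt_exp hR1]; exact ht.1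
    refine ⟨h1.le, ?_⟩
    exact (Real.lt_log_iff_exp_lt hR2).1 ht.2 |>.le
  have hloc : ∀ ζ : ℂ, ζ.re ∈ Ioo (Real.log R1) (Real.log R2) → ∃ F : ℂ → ℂ, AnalyticAt ℂ F ζ ∧
      ((fun w => b (u (a + Complex.exp w))) =ᶠ[𝓝 ζ] fun w => b (F w).re) ∧
      ((fun w => b1 (u (a + Complex.exp w))) =ᶠ[𝓝 ζ] fun w => b1 (F w).re) ∧
      (b2 (F ζ).re = 0 ∨ Real.exp ζ.re / 2 ≤ ‖deriv F ζ‖) := by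
    intro ζ hζ
    set z := a + Complex.exp ζ with hzdef
    have hnz : ‖z - a‖ = Real.exp ζ.re := by rw [hzdef, add_sub_cancel_left, Complex.norm_exp]
    have hzΩ : z ∈ Ω := hK z (by rw [hnz]; exact (hexp _ hζ).1) (by rw [hnz]; exact (hexp _ hζ).2)
    have hcE : Continuous (fun w => a + Complex.exp w) := by fun_prop
    have hcu : ContinuousAt (fun w => u (a + Complex.exp w)) ζ :=
      ContinuousAt.comp (f := fun w => a + Complex.exp w) (g := u)
        (h.contOn.continuousAt (hΩ.mem_nhds hzΩ)) hcE.continuousAt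
    rcases eq_or_lt_of_le (h.nonneg z hzΩ) with h0 | h0
    · have hsm : ∀ᶠ w in 𝓝 ζ, u (a + Complex.exp w) < ε / 2 := by
        apply hcu.eventually (gt_mem_nhds _)
        show u z < _
        rw [← h0]; positivity
      have hb0 := hbz 0 (by positivity)
      refine ⟨fun _ => 0, analyticAt_const, ?_, ?_, Or.inl ?_⟩
      · filter_upwards [hsm] with w hw
        simp [(hbz _ hw).1, hb0.1]
      · filter_upwards [hsm] with w hw
        simp [(hbz _ hw).2.1, hb0.2.1]
      · simpa using hb0.2.2
    · have hzp : z ∈ posSet Ω u := ⟨hzΩ, h0⟩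
      obtain ⟨R, hR, hball⟩ := Metric.isOpen_iff.1 (posSet_isOpen hΩ h) z hzp
      obtain ⟨f, hf, hfu⟩ := exists_hol hΩ h hball
      have hzb : z ∈ ball z R := mem_ball_self hR
      have hev : ∀ᶠ w in 𝓝 ζ, u (a + Complex.exp w) = (f (a + Complex.exp w)).re := by
        filter_upwards [hcE.continuousAt.preimage_mem_nhds (isOpen_ball.mem_nhds hzb)] with w hw
          using hfu _ hw
      have hE : AnalyticAt ℂ (fun w => a + Complex.exp w) ζ := by fun_prop
      refine ⟨fun w => f (a + Complex.exp w), AnalyticAt.fun_comp (hf z hzb) hE, ?_, ?_, ?_⟩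
      · filter_upwards [hev] with w hw; rw [hw]
      · filter_upwards [hev] with w hw; rw [hw]
      · have hfz : (f (a + Complex.exp ζ)).re = u z := (hfu z hzb).symm
        rcases le_or_gt (u z) ε with hle | hlt
        · right
          have hgr := hg z (by rw [hnz]; exact (hexp _ hζ).1) (by rw [hnz]; exact (hexp _ hζ).2) h0
            (by linarith)
          have hfd := (hf z hzb).differentiableAt
          rw [norm_grad2_eq hfd (by
            filter_upwards [isOpen_ball.mem_nhds hzb] with w hw using hfu w hw)] at hgr
          have hd : HasDerivAt (fun w => f (a + Complex.exp w)) (deriv f z * Complex.exp ζ) ζ :=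
            HasDerivAt.comp ζ hfd.hasDerivAt ((Complex.hasDerivAt_exp ζ).const_add a)
          rw [hd.deriv, norm_mul, Complex.norm_exp]
          nlinarith [Real.exp_pos ζ.re]
        · left
          simp only [hfz]
          exact hbo2 _ hlt
  have hb1C : ContDiff ℝ 1 b1 := by
    have e2 : deriv b1 = b2 := funext fun s => (hb1 s).deriv
    rw [contDiff_one_iff_deriv]
    exact ⟨fun s => (hb1 s).differentiableAt, by rw [e2]; exact hb2c⟩
  apply convex_param (W := fun w => b (u (a + Complex.exp w)))
  · intro ζ hζ
    obtain ⟨F, hF, hW, -, -⟩ := hloc ζ hζ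
    exact (lap_comp hb hb1 hb2c hF hW).1.contDiffWithinAt
  · intro w
    simp [Complex.exp_add]
  · intro t ht
    set g : ℝ → ℝ := fun θ => b1 (u (a + Complex.exp (t + θ * I))) with hgdef
    have hre : ∀ θ : ℝ, ((t:ℂ) + θ * I).re = t := by intro θ; simp
    have hγ : ∀ θ : ℝ, HasDerivAt (fun s : ℝ => (t + s * I : ℂ)) I θ := by
      intro θ
      simpa using ((Complex.ofRealCLM.hasDerivAt (x := θ)).mul_const I).const_add (t : ℂ)
    have hγc : Continuous (fun s : ℝ => (t + s * I : ℂ)) := by fun_prop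
    have hγC : ContDiff ℝ 1 (fun s : ℝ => (t + s * I : ℂ)) := by
      have : ContDiff ℝ 1 (fun s : ℝ => (s : ℂ)) := Complex.ofRealCLM.contDiff
      fun_prop
    have hgC : ContDiff ℝ 1 g := by
      rw [contDiff_iff_contDiffAt]
      intro θ
      obtain ⟨F, hF, -, hW1, -⟩ := hloc (t + θ * I) (by rw [hre]; exact ht)
      have h1 : ContDiffAt ℝ 1 F (t + θ * I) := (hF.contDiffAt (n := 1)).restrict_scalars ℝ
      have h2 : ContDiffAt ℝ 1 (fun w => b1 (F w).re) (t + θ * I) :=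
        hb1C.contDiffAt.comp _ (reCLM.contDiff.contDiffAt.comp _ h1)
      exact ContDiffAt.comp (g := fun w : ℂ => b1 (u (a + Complex.exp w))) (f := fun s : ℝ => (t + s * I : ℂ)) θ
        (h2.congr_of_eventuallyEq hW1) hγC.contDiffAt
    have hdc : Continuous (deriv g) := hgC.continuous_deriv (by norm_num)
    refine ⟨fun θ => Real.exp t / 2 * |deriv g θ|, by fun_prop, ?_, ?_⟩
    · intro θ
      obtain ⟨F, hF, hW, hW1, hor⟩ := hloc (t + θ * I) (by rw [hre]; exact ht)
      rw [(lap_comp hb hb1 hb2c hF hW).2]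
      have hgd : HasDerivAt g (b2 (F (t + θ * I)).re * (I * deriv F (t + θ * I)).re) θ := by
        have h1 := HasDerivAt.comp_hasFDerivAt (h₂ := b1) (f := fun w => (F w).re) (t + θ * I : ℂ)
          (hb1 (F (t + θ * I)).re) (hasFDerivAt_re (F := F) (z := t + θ * I) hF.differentiableAt)
        have h2 := HasFDerivAt.comp_hasDerivAt (f := fun s : ℝ => (t + s * I : ℂ)) θ (h1.congr_of_eventuallyEq hW1) (hγ θ)
        simpa [Function.comp_def] using h2
      show Real.exp t / 2 * |deriv g θ| ≤ _
      rw [hgd.deriv, abs_mul, abs_of_nonneg (hb2 _)]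
      rw [hre] at hor
      have hI : |(I * deriv F (t + θ * I)).re| ≤ ‖deriv F (t + θ * I)‖ := by
        refine (Complex.abs_re_le_norm _).trans ?_
        simp
      rcases hor with h0 | h0
      · rw [h0]; simp
      · calc Real.exp t / 2 * (b2 (F (t + θ * I)).re * |(I * deriv F (t + θ * I)).re|)
            = b2 (F (t + θ * I)).re * (Real.exp t / 2 * |(I * deriv F (t + θ * I)).re|) := by ring
          _ ≤ b2 (F (t + θ * I)).re * (‖deriv F (t + θ * I)‖ * ‖deriv F (t + θ * I)‖) := by
              apply mul_le_mul_of_nonneg_left _ (hb2 _)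
              gcongr
          _ = _ := by ring
    · have hI := hexp t ht
      have hlog : (Real.log (Real.exp t)) = t := Real.log_exp t
      obtain ⟨z0, hz0, hz0u⟩ := hz _ hI
      obtain ⟨z1, hz1, hz1u⟩ := hp _ hI
      obtain ⟨θ0, hθ0, e0⟩ := exists_polar (Real.exp_pos t) hz0
      obtain ⟨θ1, hθ1, e1⟩ := exists_polar (Real.exp_pos t) hz1
      rw [hlog] at e0 e1
      have g0 : g θ0 = 0 := by
        simp only [hgdef]; rw [← e0, hz0u]; exact (hbz 0 (by positivity)).2.1
      have g1 : g θ1 = 1 := by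
        simp only [hgdef]; rw [← e1]; exact hbo _ hz1u
      have hint : ∫ θ in θ0..θ1, deriv g θ = 1 := by
        rw [intervalIntegral.integral_deriv_eq_sub (fun x _ => hgC.differentiable (by norm_num) x)
          (hdc.intervalIntegrable _ _), g0, g1]; norm_num
      have hle : (1:ℝ) ≤ ∫ θ in (0:ℝ)..(2 * Real.pi), |deriv g θ| := by
        calc (1:ℝ) = ‖∫ θ in θ0..θ1, deriv g θ‖ := by rw [hint]; simp
          _ ≤ ∫ θ in uIoc θ0 θ1, ‖deriv g θ‖ := intervalIntegral.norm_integral_le_integral_norm_uIoc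
          _ ≤ ∫ θ in Ioc (0:ℝ) (2 * Real.pi), ‖deriv g θ‖ := by
              apply setIntegral_mono_set
              · exact ((hdc.norm).intervalIntegrable 0 (2 * Real.pi)).1
              · exact Eventually.of_forall fun _ => norm_nonneg _
              · apply LE.le.eventuallyLE
                intro x hx
                have hx : x ∈ Ioc (min θ0 θ1) (max θ0 θ1) := hx
                exact ⟨lt_of_le_of_lt (le_min hθ0.1 hθ1.1) hx.1, hx.2.trans (max_le hθ0.2 hθ1.2)⟩
          _ = _ := by
              rw [intervalIntegral.integral_of_le (by positivity)]; rfl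
      rw [intervalIntegral.integral_const_mul]
      nlinarith [Real.exp_pos t]

lemma mean_convex {Ω : Set ℂ} {u : ℂ → ℝ} (hΩ : IsOpen Ω) (h : IsClassicalSolution Ω u)
    {a : ℂ} {R1 R2 : ℝ} (hR1 : 0 < R1) (hR2 : 0 < R2)
    (hK : ∀ z, R1 ≤ ‖z - a‖ → ‖z - a‖ ≤ R2 → z ∈ Ω)
    (hz : ∀ r ∈ Icc R1 R2, ∃ z ∈ sphere a r, u z = 0)
    (hp : ∀ r ∈ Icc R1 R2, ∃ z ∈ sphere a r, 0 < u z) :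
    ConvexOn ℝ (Ioo (Real.log R1) (Real.log R2)) (fun t : ℝ =>
      (∫ θ in (0:ℝ)..(2 * Real.pi), u (a + Complex.exp (t + θ * I))) - 1 / 2 * Real.exp t) := by
  have hcomp : IsCompact {z : ℂ | R1 ≤ ‖z - a‖ ∧ ‖z - a‖ ≤ R2} := by
    apply Metric.isCompact_of_isClosed_isBounded
    · exact (isClosed_le (continuous_const (y := R1))
        (by fun_prop : Continuous fun z : ℂ => ‖z - a‖)).inter
        (isClosed_le (by fun_prop : Continuous fun z : ℂ => ‖z - a‖) continuous_const)
    · apply (Metric.isBounded_closedBall (x := a) (r := R2)).subset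
      intro z hz
      rw [mem_closedBall, dist_eq_norm]; exact hz.2
  obtain ⟨ε1, hε1, hg⟩ := grad_lower hΩ h hcomp (fun z hz => hK z hz.1 hz.2)
  obtain ⟨ε2, hε2, hpp⟩ := max_lower hΩ h.contOn hR1 hK hp
  have hmemI : ∀ t ∈ Ioo (Real.log R1) (Real.log R2), ∀ θ : ℝ, a + Complex.exp (t + θ * I) ∈ Ω := by
    intro t ht θ
    apply hK
    · rw [add_sub_cancel_left, norm_exp_polar]
      exact ((Real.log_lt_iff_lt_exp hR1).1 ht.1).le
    · rw [add_sub_cancel_left, norm_exp_polar]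
      exact ((Real.lt_log_iff_exp_lt hR2).1 ht.2).le
  have huc : ∀ t ∈ Ioo (Real.log R1) (Real.log R2), Continuous fun θ : ℝ => u (a + Complex.exp (t + θ * I)) := by
    intro t ht
    exact h.contOn.comp_continuous (by fun_prop) (hmemI t ht)
  refine ⟨convex_Ioo _ _, ?_⟩
  intro x hx y hy α β hα hβ hαβ
  have hm := (convex_Ioo (Real.log R1) (Real.log R2)) hx hy hα hβ hαβ
  apply le_of_forall_pos_le_add
  intro η hη
  set ε := min (η / (2 * Real.pi)) (min (ε1 / 2) ε2) with hεd
  have hε : 0 < ε := by positivity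
  have hεη : 2 * Real.pi * ε ≤ η := by
    have : ε ≤ η / (2 * Real.pi) := min_le_left _ _
    rw [le_div_iff₀ (by positivity)] at this
    linarith
  have hεa : ε ≤ ε1 / 2 := (min_le_right _ _).trans (min_le_left _ _)
  have hεb : ε ≤ ε2 := (min_le_right _ _).trans (min_le_right _ _)
  obtain ⟨b, b1, b2, hb, hb1, hb2c, hb2, hbz, hbo, hbo2, hbl⟩ := exists_beta hε
  have hcv := mean_convex_eps hΩ h hR1 hR2 hK hz hε
    (fun r hr => let ⟨z, hz, hzu⟩ := hpp r hr; ⟨z, hz, hεb.trans hzu⟩)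
    (fun z h1 h2 h3 h4 => hg z ⟨h1, h2⟩ h3 (by linarith)) hb hb1 hb2c hb2 hbz hbo hbo2
  have hbc : Continuous b := continuous_iff_continuousAt.2 fun s => (hb s).continuousAt
  have hle : ∀ t ∈ Ioo (Real.log R1) (Real.log R2),
      (∫ θ in (0:ℝ)..(2 * Real.pi), b (u (a + Complex.exp (t + θ * I)))) ≤
      (∫ θ in (0:ℝ)..(2 * Real.pi), u (a + Complex.exp (t + θ * I))) := by
    intro t ht
    exact intervalIntegral.integral_mono_on (by positivity)
      ((hbc.comp (huc t ht)).intervalIntegrable _ _) ((huc t ht).intervalIntegrable _ _)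
      (fun θ _ => (hbl _ (h.nonneg _ (hmemI t ht θ))).1)
  have hge : ∀ t ∈ Ioo (Real.log R1) (Real.log R2),
      (∫ θ in (0:ℝ)..(2 * Real.pi), u (a + Complex.exp (t + θ * I))) - 2 * Real.pi * ε ≤
      (∫ θ in (0:ℝ)..(2 * Real.pi), b (u (a + Complex.exp (t + θ * I)))) := by
    intro t ht
    have h1 : (∫ θ in (0:ℝ)..(2 * Real.pi), (u (a + Complex.exp (t + θ * I)) - ε)) ≤
      (∫ θ in (0:ℝ)..(2 * Real.pi), b (u (a + Complex.exp (t + θ * I)))) :=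
      intervalIntegral.integral_mono_on (by positivity)
        (((huc t ht).sub continuous_const).intervalIntegrable _ _)
        ((hbc.comp (huc t ht)).intervalIntegrable _ _)
        (fun θ _ => (hbl _ (h.nonneg _ (hmemI t ht θ))).2)
    rw [intervalIntegral.integral_sub ((huc t ht).intervalIntegrable _ _) (by simp)] at h1
    simpa using h1
  have hc := hcv.2 hx hy hα hβ hαβ
  simp only [smul_eq_mul] at hc hm ⊢
  have h1 := hge _ hm
  have h2 := mul_le_mul_of_nonneg_left (hle x hx) hα
  have h3 := mul_le_mul_of_nonneg_left (hle y hy) hβ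
  linarith

lemma local_side {Ω : Set ℂ} {u : ℂ → ℝ} (h : IsClassicalSolution Ω u)
    {a p : ℂ} {r : ℝ} (hr : 0 < r) (hs : ∀ z ∈ sphere a r, u z = 0) (hp : p ∈ FB Ω u)
    (hpr : dist p a = r) :
    (∀ᶠ z in 𝓝 p, z ∈ posSet Ω u → r < dist z a) ∨
    (∀ᶠ z in 𝓝 p, z ∈ posSet Ω u → dist z a < r) := by
  obtain ⟨V, hV, hpV, hVΩ, φ, hφ, hφd, hpos, hzero, hfb⟩ := h.fb_manifold p hp
  obtain ⟨θ, -, hθ⟩ := exists_polar hr (show p ∈ sphere a r from hpr)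
  set ζ : ℂ := (Real.log r : ℝ) + θ * I with hζ
  have hζre : ζ.re = Real.log r := by simp [hζ]
  have hE : HasStrictDerivAt (fun w => a + Complex.exp w) (Complex.exp ζ) ζ :=
    (Complex.hasStrictDerivAt_exp ζ).const_add a
  have hφp : ContDiffAt ℝ 1 φ (a + Complex.exp ζ) := by
    rw [← hθ]
    exact (hφ.contDiffAt (hV.mem_nhds hpV)).of_le (by exact_mod_cast le_top)
  have hφs : HasStrictFDerivAt φ (fderiv ℝ φ (a + Complex.exp ζ)) (a + Complex.exp ζ) :=
    hφp.hasStrictFDerivAt (by norm_num)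
  have hEs : HasStrictFDerivAt (fun w => a + Complex.exp w)
      ((ContinuousLinearMap.toSpanSingleton ℂ (Complex.exp ζ)).restrictScalars ℝ) ζ :=
    hE.hasStrictFDerivAt.restrictScalars ℝ
  set ψ : ℂ → ℝ := fun w => φ (a + Complex.exp w) with hψ
  set L : ℂ →L[ℝ] ℝ := (fderiv ℝ φ (a + Complex.exp ζ)).comp
    ((ContinuousLinearMap.toSpanSingleton ℂ (Complex.exp ζ)).restrictScalars ℝ) with hL
  have hψs : HasStrictFDerivAt ψ L ζ := HasStrictFDerivAt.comp (g := φ) ζ hφs hEs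
  have hEc : Continuous (fun w => a + Complex.exp w) := by fun_prop
  have hVe : ∀ᶠ w in 𝓝 ζ, a + Complex.exp w ∈ V :=
    hEc.continuousAt.preimage_mem_nhds (hV.mem_nhds (by rw [← hθ]; exact hpV))
  have hsph : ∀ w : ℂ, w.re = Real.log r → a + Complex.exp w ∈ sphere a r := by
    intro w hw
    rw [mem_sphere, dist_eq_norm, add_sub_cancel_left, Complex.norm_exp, hw, Real.exp_log hr]
  have hle : ∀ w : ℂ, w.re = Real.log r → a + Complex.exp w ∈ V → ψ w ≤ 0 := by
    intro w hw hwV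
    have : a + Complex.exp w ∈ V ∩ {w | u w = 0} := ⟨hwV, hs _ (hsph w hw)⟩
    rw [hzero] at this
    exact this.2
  have hψ0 : ψ ζ = 0 := by
    have : p ∈ V ∩ FB Ω u := ⟨hpV, hp⟩
    rw [hfb] at this
    simp only [hψ]
    rw [← hθ]; exact this.2
  have hLI : L I = 0 := by
    have hγ : HasDerivAt (fun s : ℝ => (ζ + s * I : ℂ)) I 0 := by
      simpa using ((Complex.ofRealCLM.hasDerivAt (x := (0:ℝ))).mul_const I).const_add ζ
    have hγc : Continuous (fun s : ℝ => (ζ + s * I : ℂ)) := by fun_prop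
    have hd : HasDerivAt (fun s : ℝ => ψ (ζ + s * I)) (L I) 0 := by
      refine HasFDerivAt.comp_hasDerivAt (l := ψ) (f := fun s : ℝ => (ζ + s * I : ℂ)) 0 ?_ hγ
      simpa using hψs.hasFDerivAt
    have hm : IsLocalMax (fun s : ℝ => ψ (ζ + s * I)) 0 := by
      have : ∀ᶠ s : ℝ in 𝓝 0, a + Complex.exp (ζ + s * I) ∈ V := by
        have ht : Tendsto (fun s : ℝ => (ζ + s * I : ℂ)) (𝓝 0) (𝓝 ζ) := by
          simpa using hγc.tendsto 0
        exact ht.eventually hVe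
      filter_upwards [this] with s hs
      have := hle (ζ + s * I) (by simp [hζre]) hs
      simpa [hψ0] using this
    exact hm.hasDerivAt_eq_zero hd
  have hL1 : L 1 ≠ 0 := by
    intro h1
    have hL0 : L = 0 := by
      ext z
      have hz : z = z.re • (1:ℂ) + z.im • I := by simp
      rw [hz, map_add, map_smul, map_smul, h1, hLI]; simp
    apply hφd p hpV
    ext v
    have := congrArg (fun l : ℂ →L[ℝ] ℝ => l (v / Complex.exp ζ)) hL0
    simp [hL] at this
    rw [hθ]; simpa using this
  have hkey : ∀ᶠ w in 𝓝 ζ, 0 < ψ w → 0 < L 1 * (w.re - Real.log r) := by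
    have ho := hψs.isLittleO.bound (c := |L 1| / 2) (by positivity)
    have ht : Tendsto (fun w : ℂ => (w, ((Real.log r : ℝ) + w.im * I : ℂ))) (𝓝 ζ) (𝓝 (ζ, ζ)) := by
      have hc : Continuous (fun w : ℂ => (w, ((Real.log r : ℝ) + w.im * I : ℂ))) := by fun_prop
      have := hc.tendsto ζ
      have e : ((Real.log r : ℝ) + ζ.im * I : ℂ) = ζ := by simp [hζ]
      rwa [e] at this
    have hV2 : ∀ᶠ w in 𝓝 ζ, a + Complex.exp ((Real.log r : ℝ) + w.im * I : ℂ) ∈ V :=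
      (tendsto_snd.comp (nhds_prod_eq (X := ℂ) (Y := ℂ) ▸ ht)).eventually hVe
    filter_upwards [ht.eventually ho, hV2] with w hw hwV hwp
    have e : (w - ((Real.log r : ℝ) + w.im * I : ℂ)) = (w.re - Real.log r) • (1:ℂ) := by
      apply Complex.ext <;> simp
    have h2 := hle _ (by simp) hwV
    rw [e, map_smul, norm_smul, norm_one, mul_one, Real.norm_eq_abs, Real.norm_eq_abs, smul_eq_mul] at hw
    by_contra hneg
    push Not at hneg
    have h3 := (abs_le.1 hw).2
    have h4 : |L 1| * |w.re - Real.log r| = -(L 1 * (w.re - Real.log r)) := by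
      rw [← abs_mul, abs_of_nonpos hneg]
    nlinarith
  have hkey2 : ∀ᶠ z in 𝓝 p, z ∈ posSet Ω u → 0 < L 1 * (Real.log (dist z a) - Real.log r) := by
    rw [hθ, ← hE.map_nhds_eq (Complex.exp_ne_zero _), eventually_map]
    filter_upwards [hkey, hVe] with w hw hwV hwp
    have : a + Complex.exp w ∈ V ∩ posSet Ω u := ⟨hwV, hwp⟩
    rw [hpos] at this
    have := hw this.2
    rwa [dist_eq_norm, add_sub_cancel_left, Complex.norm_exp, Real.log_exp]
  have hda : ∀ᶠ z in 𝓝 p, 0 < dist z a := by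
    have hc : Continuous (fun z => dist z a) := by fun_prop
    exact hc.continuousAt.eventually (lt_mem_nhds (by simp only [hpr]; exact hr))
  rcases lt_or_gt_of_ne hL1 with h1 | h1
  · right
    filter_upwards [hkey2, hda] with z hz hz0 hzp
    have := hz hzp
    exact (Real.log_lt_log_iff hz0 hr).1 (by nlinarith)
  · left
    filter_upwards [hkey2, hda] with z hz hz0 hzp
    have := hz hzp
    exact (Real.log_lt_log_iff hr hz0).1 (by nlinarith)

lemma cross_zero {Ω : Set ℂ} {u : ℂ → ℝ} (hΩ : IsOpen Ω) (h : IsClassicalSolution Ω u)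
    {a : ℂ} {r : ℝ} {F : Set ℂ} (hF : IsPreconnected F) (hFB : F ⊆ FB Ω u)
    (h1 : ∃ p ∈ F, dist p a < r) (h2 : ∃ p ∈ F, r < dist p a) : ∃ z ∈ sphere a r, u z = 0 := by
  obtain ⟨p, hp, hpr⟩ := h1
  obtain ⟨q, hq, hqr⟩ := h2
  obtain ⟨z, hz, hzr⟩ := hF.intermediate_value hp hq
    (f := fun z => dist z a) (by fun_prop) (show r ∈ Icc _ _ from ⟨hpr.le, hqr.le⟩)
  exact ⟨z, hzr, FB_zero hΩ h (hFB hz)⟩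

lemma cross_pos {Ω : Set ℂ} {u : ℂ → ℝ} (h : IsClassicalSolution Ω u)
    {a : ℂ} {r : ℝ} (hr : 0 < r) (hsΩ : sphere a r ⊆ Ω)
    {F : Set ℂ} (hF : IsPreconnected F) (hFB : F ⊆ FB Ω u)
    (h1 : ∃ p ∈ F, dist p a < r) (h2 : ∃ p ∈ F, r < dist p a) : ∃ z ∈ sphere a r, 0 < u z := by
  by_contra! hcon
  have hs : ∀ z ∈ sphere a r, u z = 0 := fun z hz => le_antisymm (hcon z hz) (h.nonneg z (hsΩ hz))
  have hdc : Continuous (fun z : ℂ => dist z a) := by fun_prop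
  have hin : ∀ p, dist p a < r → ∀ᶠ z in 𝓝 p, z ∈ posSet Ω u → dist z a < r := by
    intro p hp
    filter_upwards [hdc.continuousAt.eventually (gt_mem_nhds hp)] with z hz _ using hz
  have hout : ∀ p, r < dist p a → ∀ᶠ z in 𝓝 p, z ∈ posSet Ω u → r < dist z a := by
    intro p hp
    filter_upwards [hdc.continuousAt.eventually (lt_mem_nhds hp)] with z hz _ using hz
  obtain ⟨p, hp, hpr⟩ := h1
  obtain ⟨q, hq, hqr⟩ := h2
  obtain ⟨x, hxF, hx1, hx2⟩ := hF {p | ∀ᶠ z in 𝓝 p, z ∈ posSet Ω u → dist z a < r}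
    {p | ∀ᶠ z in 𝓝 p, z ∈ posSet Ω u → r < dist z a} isOpen_setOfPred_eventually_nhds
    isOpen_setOfPred_eventually_nhds (by
      intro x hx
      rcases lt_trichotomy (dist x a) r with hlt | heq | hgt
      · exact Or.inl (hin x hlt)
      · exact (local_side h hr hs (hFB hx) heq).symm
      · exact Or.inr (hout x hgt)) ⟨p, hp, hin p hpr⟩ ⟨q, hq, hout q hqr⟩
  have hfr : ∃ᶠ z in 𝓝 x, z ∈ posSet Ω u :=
    mem_closure_iff_frequently.1 (frontier_subset_closure (hFB hxF).2)
  obtain ⟨z, hz, h1, h2⟩ := (hfr.and_eventually (hx1.and hx2)).exists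
  exact absurd (h1 hz) (not_lt.2 (h2 hz).le)

lemma max_principle {Ω : Set ℂ} {u : ℂ → ℝ} (hΩ : IsOpen Ω) (h : IsClassicalSolution Ω u)
    {a : ℂ} {r : ℝ} (hr : 0 < r) (hb : closedBall a r ⊆ Ω) :
    ∃ y ∈ sphere a r, ∀ z ∈ closedBall a r, u z ≤ u y := by
  have huc : ContinuousOn u (closedBall a r) := h.contOn.mono hb
  have hcb := isCompact_closedBall a r
  obtain ⟨z0, hz0, hmax⟩ := hcb.exists_isMaxOn ⟨a, mem_closedBall_self hr.le⟩ huc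
  have hS : IsCompact {z ∈ closedBall a r | u z = u z0} := by
    have : {z ∈ closedBall a r | u z = u z0} = closedBall a r ∩ u ⁻¹' {u z0} := by ext; simp
    rw [this]
    exact hcb.of_isClosed_subset (huc.preimage_isClosed_of_isClosed isClosed_closedBall
      isClosed_singleton) inter_subset_left
  obtain ⟨z1, hz1, hz1m⟩ := hS.exists_isMaxOn ⟨z0, hz0, rfl⟩
    (f := fun z => dist z a) (by fun_prop)
  rcases eq_or_lt_of_le (mem_closedBall.1 hz1.1) with heq | hlt
  · exact ⟨z1, heq, fun z hz => by rw [hz1.2]; exact hmax hz⟩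
  rcases eq_or_lt_of_le (h.nonneg z0 (hb hz0)) with h0 | h0
  · have hy : a + (r : ℂ) ∈ sphere a r := by
      rw [mem_sphere, dist_eq_norm, add_sub_cancel_left, Complex.norm_real, Real.norm_eq_abs,
        abs_of_pos hr]
    refine ⟨a + (r : ℂ), hy, fun z hz => ?_⟩
    have h1 : u z ≤ u z0 := hmax hz
    have h2 := h.nonneg _ (hb (sphere_subset_closedBall hy))
    linarith
  exfalso
  have hz1p : z1 ∈ posSet Ω u := ⟨hb hz1.1, by rw [hz1.2]; exact h0⟩
  have hopen : IsOpen (posSet Ω u ∩ ball a r) := (posSet_isOpen hΩ h).inter isOpen_ball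
  obtain ⟨R, hR, hball⟩ := Metric.isOpen_iff.1 hopen z1 ⟨hz1p, hlt⟩
  obtain ⟨f, hf, hfu⟩ := exists_hol hΩ h (hball.trans inter_subset_left)
  have hzb : z1 ∈ ball z1 R := mem_ball_self hR
  have hnear : ∀ᶠ z in 𝓝 z1, z ∈ ball z1 R := isOpen_ball.mem_nhds hzb
  have hev : ∀ᶠ z in 𝓝 z1, ‖Complex.exp (f z)‖ = ‖Complex.exp (f z1)‖ := by
    apply Complex.norm_eventually_eq_of_isLocalMax (f := fun z => Complex.exp (f z))
    · filter_upwards [hnear] with z hz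
      exact (hf z hz).differentiableAt.cexp
    · filter_upwards [hnear] with z hz
      simp only [Function.comp_apply, Complex.norm_exp, Real.exp_le_exp]
      rw [← hfu z hz, ← hfu z1 hzb, hz1.2]
      exact hmax (ball_subset_closedBall (hball hz).2)
  have hev2 : ∀ᶠ z in 𝓝 z1, dist z a ≤ dist z1 a := by
    filter_upwards [hev, hnear] with z hz hzR
    apply hz1m
    refine ⟨ball_subset_closedBall (hball hzR).2, ?_⟩
    rw [Complex.norm_exp, Complex.norm_exp, Real.exp_eq_exp, ← hfu z hzR, ← hfu z1 hzb, hz1.2] at hz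
    exact hz
  by_cases hza : z1 = a
  · subst hza
    have ht : Tendsto (fun t : ℝ => z1 + (t : ℂ)) (𝓝[>] 0) (𝓝 z1) := by
      have hc : Continuous (fun t : ℝ => z1 + (t : ℂ)) := by fun_prop
      have := (hc.tendsto 0).mono_left (nhdsWithin_le_nhds (s := Ioi 0))
      simpa using this
    obtain ⟨t, h1, h2⟩ := ((ht.eventually hev2).and self_mem_nhdsWithin).exists
    rw [dist_self, dist_le_zero] at h1
    have h2 : 0 < t := h2
    simp at h1
    exact h2.ne' h1
  · have ht : Tendsto (fun t : ℝ => z1 + (t : ℂ) * (z1 - a)) (𝓝[>] 0) (𝓝 z1) := by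
      have hc : Continuous (fun t : ℝ => z1 + (t : ℂ) * (z1 - a)) := by fun_prop
      have := (hc.tendsto 0).mono_left (nhdsWithin_le_nhds (s := Ioi 0))
      simpa using this
    obtain ⟨t, h1, h2⟩ := ((ht.eventually hev2).and self_mem_nhdsWithin).exists
    have h2 : 0 < t := h2
    have e : z1 + (t : ℂ) * (z1 - a) - a = ((1 + t : ℝ) : ℂ) * (z1 - a) := by push_cast; ring
    rw [dist_eq_norm, dist_eq_norm, e, norm_mul, Complex.norm_real, Real.norm_eq_abs,
      abs_of_pos (by linarith)] at h1
    have : 0 < ‖z1 - a‖ := norm_pos_iff.2 (sub_ne_zero.2 hza)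
    nlinarith

lemma bdd_sphere {Ω : Set ℂ} {u : ℂ → ℝ} (hu : ContinuousOn u Ω) {a : ℂ} {r : ℝ}
    (hs : sphere a r ⊆ Ω) : BddAbove (u '' sphere a r) :=
  ((isCompact_sphere a r).image_of_continuousOn (hu.mono hs)).bddAbove

lemma sSup_ball_eq {Ω : Set ℂ} {u : ℂ → ℝ} (hΩ : IsOpen Ω) (h : IsClassicalSolution Ω u)
    {a : ℂ} {r : ℝ} (hr : 0 < r) (hb : closedBall a r ⊆ Ω) :
    sSup (u '' ball a r) = sSup (u '' sphere a r) := by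
  obtain ⟨y, hy, hmax⟩ := max_principle hΩ h hr hb
  have hbs := bdd_sphere h.contOn (sphere_subset_closedBall.trans hb)
  have hbb : BddAbove (u '' ball a r) := by
    refine ⟨u y, ?_⟩
    rintro _ ⟨z, hz, rfl⟩
    exact hmax z (ball_subset_closedBall hz)
  apply le_antisymm
  · apply csSup_le (⟨u a, a, mem_ball_self hr, rfl⟩ : (u '' ball a r).Nonempty)
    rintro _ ⟨z, hz, rfl⟩
    exact (hmax z (ball_subset_closedBall hz)).trans (le_csSup hbs ⟨y, hy, rfl⟩)
  · apply csSup_le (⟨u y, y, hy, rfl⟩ : (u '' sphere a r).Nonempty)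
    rintro _ ⟨z, hz, rfl⟩
    by_contra! hlt
    have hzc : z ∈ closure (ball a r) := by
      rw [closure_ball a hr.ne']; exact sphere_subset_closedBall hz
    have hcu := h.contOn.continuousAt (hΩ.mem_nhds (hb (sphere_subset_closedBall hz)))
    obtain ⟨w, hw, hw2⟩ := ((mem_closure_iff_frequently.1 hzc).and_eventually
      (hcu.eventually (lt_mem_nhds hlt))).exists
    exact absurd (le_csSup hbb ⟨w, hw, rfl⟩) (not_le.2 hw2)

lemma mean_le {Ω : Set ℂ} {u : ℂ → ℝ} (hu : ContinuousOn u Ω)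
    {a : ℂ} {t : ℝ} (hs : sphere a (Real.exp t) ⊆ Ω) {B : ℝ}
    (hB : ∀ z ∈ sphere a (Real.exp t), u z ≤ B) :
    (∫ θ in (0:ℝ)..(2 * Real.pi), u (a + Complex.exp (t + θ * I))) ≤ 2 * Real.pi * B := by
  have hm : ∀ θ : ℝ, a + Complex.exp (t + θ * I) ∈ sphere a (Real.exp t) := by
    intro θ
    rw [mem_sphere, dist_eq_norm, add_sub_cancel_left, norm_exp_polar]
  have hc : Continuous fun θ : ℝ => u (a + Complex.exp (t + θ * I)) :=
    hu.comp_continuous (by fun_prop) (fun θ => hs (hm θ))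
  have := intervalIntegral.integral_mono_on (a := 0) (b := 2 * Real.pi) (by positivity)
    (μ := volume) (hc.intervalIntegrable _ _) (intervalIntegrable_const (c := B)) (fun θ _ => hB _ (hm θ))
  simpa using this

lemma mean_nonneg {Ω : Set ℂ} {u : ℂ → ℝ} (hu : ∀ z ∈ Ω, 0 ≤ u z)
    {a : ℂ} {t : ℝ} (hs : sphere a (Real.exp t) ⊆ Ω) :
    0 ≤ (∫ θ in (0:ℝ)..(2 * Real.pi), u (a + Complex.exp (t + θ * I))) := by
  apply intervalIntegral.integral_nonneg (by positivity)
  intro θ _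
  apply hu _ (hs _)
  rw [mem_sphere, dist_eq_norm, add_sub_cancel_left, norm_exp_polar]

lemma mean_le_sup {Ω : Set ℂ} {u : ℂ → ℝ} (hu : ContinuousOn u Ω)
    {a : ℂ} {r : ℝ} (hr : 0 < r) (hs : sphere a r ⊆ Ω) :
    (∫ θ in (0:ℝ)..(2 * Real.pi), u (a + Complex.exp ((Real.log r : ℝ) + θ * I))) ≤
      2 * Real.pi * sSup (u '' sphere a r) := by
  apply mean_le hu
  · rwa [Real.exp_log hr]
  · intro z hz
    rw [Real.exp_log hr] at hz
    exact le_csSup (bdd_sphere hu hs) ⟨z, hz, rfl⟩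

lemma growth_i {Ω : Set ℂ} {u : ℂ → ℝ} (hΩ : IsOpen Ω) (h : IsClassicalSolution Ω u)
    {a : ℂ} {r R : ℝ} (hr : 0 < r) (hrR : r < R) (hb : closedBall a R ⊆ Ω)
    {F : Set ℂ} (hF : IsPreconnected F) (hFB : F ⊆ FB Ω u) (haF : a ∈ F)
    (hout : ∃ q ∈ F, R < dist q a) : r / (4 * Real.pi) ≤ sSup (u '' sphere a r) := by
  have hsub : ∀ ρ ≤ R, sphere a ρ ⊆ Ω := fun ρ hρ =>
    sphere_subset_closedBall.trans ((closedBall_subset_closedBall hρ).trans hb)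
  have hconv : ∀ R1, 0 < R1 → ConvexOn ℝ (Ioo (Real.log R1) (Real.log R)) (fun t : ℝ =>
      (∫ θ in (0:ℝ)..(2 * Real.pi), u (a + Complex.exp (t + θ * I))) - 1 / 2 * Real.exp t) := by
    intro R1 hR1
    have hin : ∀ ρ ∈ Icc R1 R, ∃ p ∈ F, dist p a < ρ := fun ρ hρ =>
      ⟨a, haF, by rw [dist_self]; exact hR1.trans_le hρ.1⟩
    have hou : ∀ ρ ∈ Icc R1 R, ∃ p ∈ F, ρ < dist p a := fun ρ hρ =>
      let ⟨q, hq, hqR⟩ := hout; ⟨q, hq, hρ.2.trans_lt hqR⟩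
    apply mean_convex hΩ h hR1 (hr.trans hrR)
    · intro z _ hz
      apply hb; rw [mem_closedBall, dist_eq_norm]; exact hz
    · intro ρ hρ
      exact cross_zero hΩ h hF hFB (hin ρ hρ) (hou ρ hρ)
    · intro ρ hρ
      exact cross_pos h (hR1.trans_le hρ.1) (hsub ρ hρ.2) hF hFB (hin ρ hρ) (hou ρ hρ)
  set J : ℝ → ℝ := fun t => ∫ θ in (0:ℝ)..(2 * Real.pi), u (a + Complex.exp (t + θ * I)) with hJ
  set T := Real.log r with hT
  have hTR : T < Real.log R := Real.log_lt_log hr hrR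
  obtain ⟨y, hy, hmax⟩ := max_principle hΩ h (hr.trans hrR) hb
  have hexpR : ∀ t ≤ T, Real.exp t ≤ R := by
    intro t ht
    have : Real.exp t ≤ Real.exp T := Real.exp_le_exp.2 ht
    rw [hT, Real.exp_log hr] at this
    linarith
  have hJle : ∀ t ≤ T, J t ≤ 2 * Real.pi * u y := by
    intro t ht
    exact mean_le h.contOn (hsub _ (hexpR t ht)) (fun z hz =>
      hmax z (sphere_subset_closedBall.trans (closedBall_subset_closedBall (hexpR t ht)) hz))
  have hJ0 : ∀ t ≤ T, 0 ≤ J t := fun t ht => mean_nonneg h.nonneg (hsub _ (hexpR t ht))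
  have hstep : ∀ n : ℕ, -(1 / 2 * (r * Real.exp (-((n:ℝ) + 1)))) ≤
      (1 / ((n:ℝ) + 1)) * (2 * Real.pi * u y) + (1 - 1 / ((n:ℝ) + 1)) * (J T - 1 / 2 * r) := by
    intro n
    set m : ℝ := (n:ℝ) + 1 with hm
    have hm1 : 1 ≤ m := by rw [hm]; linarith [Nat.cast_nonneg (α := ℝ) n]
    have hm0 : 0 < m := by linarith
    have hm2 : 0 ≤ 1 / m := by positivity
    have hm3 : 0 ≤ 1 - 1 / m := by rw [sub_nonneg, div_le_one hm0]; exact hm1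
    have hx1 : T - m * m ∈ Ioo (Real.log (Real.exp (T - m * m - 1))) (Real.log R) := by
      rw [Real.log_exp]; constructor <;> nlinarith
    have hx2 : T ∈ Ioo (Real.log (Real.exp (T - m * m - 1))) (Real.log R) := by
      rw [Real.log_exp]; constructor <;> nlinarith
    have hcv := hconv (Real.exp (T - m * m - 1)) (Real.exp_pos _)
    have hc := hcv.2 hx1 hx2 hm2 hm3 (by ring)
    simp only [smul_eq_mul] at hc
    have e : 1 / m * (T - m * m) + (1 - 1 / m) * T = T - m := by field_simp; ring
    rw [e] at hc
    have h1 := hJ0 (T - m) (by linarith)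
    have h2 := hJle (T - m * m) (by nlinarith)
    have h3 : Real.exp (T - m) = r * Real.exp (-m) := by
      rw [sub_eq_add_neg, Real.exp_add, hT, Real.exp_log hr]
    have h4 : Real.exp T = r := by rw [hT, Real.exp_log hr]
    have h5 : 1 / m * (J (T - m * m) - 1 / 2 * Real.exp (T - m * m)) ≤ 1 / m * (2 * Real.pi * u y) := by
      apply mul_le_mul_of_nonneg_left _ (by positivity)
      linarith [Real.exp_pos (T - m * m)]
    have hc' : J (T - m) - 1 / 2 * Real.exp (T - m) ≤
      1 / m * (J (T - m * m) - 1 / 2 * Real.exp (T - m * m)) + (1 - 1 / m) * (J T - 1 / 2 * Real.exp T) := by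
      simpa only [hJ, Complex.ofReal_sub, Complex.ofReal_mul] using hc
    rw [h3, h4] at hc'
    linarith
  have hlim0 : Tendsto (fun n : ℕ => 1 / ((n:ℝ) + 1)) atTop (𝓝 0) := tendsto_one_div_add_atTop_nhds_zero_nat
  have hlimE : Tendsto (fun n : ℕ => Real.exp (-((n:ℝ) + 1))) atTop (𝓝 0) := by
    apply Real.tendsto_exp_neg_atTop_nhds_zero.comp
    exact tendsto_atTop_add_const_right _ _ tendsto_natCast_atTop_atTop
  have hL : Tendsto (fun n : ℕ => -(1 / 2 * (r * Real.exp (-((n:ℝ) + 1))))) atTop (𝓝 (-(1 / 2 * (r * 0)))) :=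
    ((hlimE.const_mul r).const_mul (1 / 2)).neg
  have hRt : Tendsto (fun n : ℕ => (1 / ((n:ℝ) + 1)) * (2 * Real.pi * u y) + (1 - 1 / ((n:ℝ) + 1)) * (J T - 1 / 2 * r))
      atTop (𝓝 (0 * (2 * Real.pi * u y) + (1 - 0) * (J T - 1 / 2 * r))) :=
    (hlim0.mul_const _).add ((hlim0.const_sub 1).mul_const _)
  have hfin := le_of_tendsto_of_tendsto' hL hRt hstep
  have hsup : J T ≤ 2 * Real.pi * sSup (u '' sphere a r) := mean_le_sup h.contOn hr (hsub r hrR.le)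
  rw [div_le_iff₀ (by positivity)]
  linarith

lemma ann_isOpen (δ R : ℝ) : IsOpen (ann δ R) :=
  (isOpen_lt continuous_const continuous_norm).inter (isOpen_lt continuous_norm continuous_const)

lemma near_zero_bound {Ω : Set ℂ} {u : ℂ → ℝ} (hΩ : IsOpen Ω) (h : IsClassicalSolution Ω u)
    {x : ℂ} {d : ℝ} (hd : 0 < d) (hb : closedBall x d ⊆ Ω)
    (hz : ∃ z ∈ closedBall x d, u z = 0) : u x ≤ 4 * d := by
  rcases eq_or_lt_of_le (h.nonneg x (hb (mem_closedBall_self hd.le))) with h0 | h0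
  · rw [← h0]; positivity
  have huc : ContinuousOn u (closedBall x d) := h.contOn.mono hb
  have hcb := isCompact_closedBall x d
  have hS : IsCompact {z ∈ closedBall x d | u z = 0} := by
    have : {z ∈ closedBall x d | u z = 0} = closedBall x d ∩ u ⁻¹' {0} := by ext; simp
    rw [this]
    exact hcb.of_isClosed_subset (huc.preimage_isClosed_of_isClosed isClosed_closedBall
      isClosed_singleton) inter_subset_left
  obtain ⟨z, hz, hzu⟩ := hz
  obtain ⟨p, hp, hpm⟩ := hS.exists_isMinOn ⟨z, hz, hzu⟩
    (f := fun z => dist z x) (by fun_prop)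
  have hpx : p ≠ x := by
    rintro rfl
    exact h0.ne' hp.2
  have hdp : 0 < dist p x := dist_pos.2 hpx
  have hpd : dist p x ≤ d := hp.1
  have hball : ball x (dist p x) ⊆ posSet Ω u := by
    intro w hw
    have hwd : w ∈ closedBall x d := (mem_ball.1 hw).le.trans hpd
    refine ⟨hb hwd, lt_of_le_of_ne (h.nonneg w (hb hwd)) fun he => ?_⟩
    have : dist p x ≤ dist w x := hpm ⟨hwd, he.symm⟩
    exact absurd (mem_ball.1 hw) (not_lt.2 this)
  have hpFB : p ∈ FB Ω u := by
    refine ⟨hb hp.1, ?_⟩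
    rw [(posSet_isOpen hΩ h).frontier_eq]
    refine ⟨closure_mono hball ?_, fun hh => hh.2.ne' hp.2⟩
    rw [closure_ball x hdp.ne']
    exact mem_closedBall.2 le_rfl
  have := hopf hΩ h hdp hball hpFB rfl
  linarith

lemma circle_bound {δ : ℝ} (hδ : 0 < δ) (hδ4 : δ < 1 / 4) {u : ℂ → ℝ}
    (h : IsClassicalSolution (ann δ 1) u) (hz : ∃ z ∈ sphere (0:ℂ) (2 * δ), u z = 0) :
    ∀ z ∈ sphere (0:ℂ) (2 * δ), u z ≤ 3 ^ 56 * (2 * δ) := by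
  have hΩ := ann_isOpen δ 1
  have h2δ : 0 < 2 * δ := by linarith
  set P : ℝ → ℂ := fun θ => 0 + Complex.exp ((Real.log (2 * δ) : ℝ) + θ * I) with hP
  have hPn : ∀ θ, ‖P θ‖ = 2 * δ := by
    intro θ
    simp only [hP]
    rw [zero_add, norm_exp_polar, Real.exp_log h2δ]
  have hPΩ : ∀ θ, closedBall (P θ) (δ / 2) ⊆ ann δ 1 := by
    intro θ z hz
    rw [mem_closedBall, dist_eq_norm] at hz
    have h1 := norm_sub_norm_le z (P θ)
    have h2 := norm_sub_norm_le (P θ) z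
    rw [norm_sub_rev] at h2
    rw [hPn] at h1 h2
    exact ⟨by linarith, by linarith⟩
  have hPd : ∀ θ θ', |θ - θ'| ≤ 1 / 8 → dist (P θ') (P θ) ≤ δ / 4 := by
    intro θ θ' hθ
    have e : P θ' - P θ = ((2 * δ : ℝ) : ℂ) * Complex.exp (θ * I) * (Complex.exp (I * ((θ' - θ : ℝ):ℂ)) - 1) := by
      simp only [hP, zero_add]
      rw [Complex.exp_add, Complex.exp_add, ← Complex.ofReal_exp, Real.exp_log h2δ, mul_sub, mul_one,
        mul_assoc, ← Complex.exp_add]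
      congr 3
      push_cast; ring
    rw [dist_eq_norm, e, norm_mul, norm_mul, Complex.norm_real, Complex.norm_exp_ofReal_mul_I,
      Real.norm_eq_abs, abs_of_pos h2δ, mul_one]
    have h3 : ‖Complex.exp (I * ((θ' - θ : ℝ):ℂ)) - 1‖ ≤ ‖θ' - θ‖ := Real.norm_exp_I_mul_ofReal_sub_one_le
    rw [Real.norm_eq_abs, abs_sub_comm] at h3
    nlinarith
  obtain ⟨z0, hz0, hz0u⟩ := hz
  obtain ⟨θ0, hθ0, e0⟩ := exists_polar h2δ hz0
  have hchain : ∀ n : ℕ, ∀ θ, |θ - θ0| ≤ n / 8 → u (P θ) ≤ 3 ^ n * (2 * δ) := by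
    intro n
    induction n with
    | zero =>
      intro θ hθ
      have : θ = θ0 := by
        rw [Nat.cast_zero, zero_div] at hθ
        exact sub_eq_zero.1 (abs_nonpos_iff.1 hθ)
      subst this
      have : u (P θ) = 0 := by simp only [hP]; rw [← e0]; exact hz0u
      rw [this]; positivity
    | succ n ih =>
      intro θ hθ
      have h3n : (1:ℝ) ≤ 3 ^ (n + 1) := one_le_pow₀ (by norm_num)
      by_cases hzz : ∃ z ∈ closedBall (P θ) (δ / 2), u z = 0
      · have := near_zero_bound hΩ h (by linarith : 0 < δ / 2) (hPΩ θ) hzz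
        nlinarith
      · push Not at hzz
        have hball : ball (P θ) (δ / 2) ⊆ posSet (ann δ 1) u := by
          intro w hw
          have hw' := ball_subset_closedBall hw
          exact ⟨hPΩ θ hw', lt_of_le_of_ne (h.nonneg w (hPΩ θ hw')) (hzz w hw').symm⟩
        obtain ⟨θ', hθ'1, hθ'2⟩ : ∃ θ', |θ - θ'| ≤ 1 / 8 ∧ |θ' - θ0| ≤ n / 8 := by
          push_cast at hθ
          have hn : (0:ℝ) ≤ (n:ℝ) := Nat.cast_nonneg n
          have hk : ((n:ℝ) + 1) ≠ 0 := by positivity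
          refine ⟨θ0 + (n / (n + 1)) * (θ - θ0), ?_, ?_⟩
          · have e : θ - (θ0 + (n / (n + 1)) * (θ - θ0)) = (1 / ((n:ℝ) + 1)) * (θ - θ0) := by
              field_simp; ring
            rw [e, abs_mul, abs_of_nonneg (by positivity)]
            calc _ ≤ (1 / ((n:ℝ) + 1)) * ((n + 1) / 8) := by gcongr
              _ = 1 / 8 := by field_simp
          · rw [add_sub_cancel_left, abs_mul, abs_of_nonneg (by positivity)]
            calc _ ≤ (n / ((n:ℝ) + 1)) * ((n + 1) / 8) := by gcongr
              _ = n / 8 := by field_simp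
        have hdist := hPd θ θ' hθ'1
        have hmem : P θ' ∈ ball (P θ) (δ / 2) := by rw [mem_ball]; linarith
        have hH := harnack hΩ h hball hmem
        have h1 := ih θ' hθ'2
        have hp1 := (hball hmem).2
        have hp2 := (hball (mem_ball_self (by linarith : 0 < δ / 2))).2
        have h5 : u (P θ) * (δ / 4) ≤ u (P θ') * (3 * δ / 4) := by
          calc u (P θ) * (δ / 4) ≤ u (P θ) * (δ / 2 - dist (P θ') (P θ)) := by
                apply mul_le_mul_of_nonneg_left _ hp2.le; linarith
            _ ≤ _ := hH
            _ ≤ _ := by apply mul_le_mul_of_nonneg_left _ hp1.le; linarith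
        have h6 : u (P θ) ≤ 3 * u (P θ') := by
          by_contra! hc
          nlinarith
        rw [pow_succ]
        linarith
  intro z hz
  obtain ⟨θ, hθ, e⟩ := exists_polar h2δ hz
  have := hchain 56 θ (by
    have hpi := Real.pi_lt_d2
    rw [abs_le]
    push_cast
    constructor <;> linarith [hθ.1, hθ.2, hθ0.1, hθ0.2])
  rw [e]; exact this

lemma condA_comp {δ : ℝ} {u : ℂ → ℝ} (hA : ConditionA δ 1 u) {x : ℂ} (hx : x ∈ FB (ann δ 1) u) :
    ∃ F : Set ℂ, x ∈ F ∧ IsPreconnected F ∧ F ⊆ FB (ann δ 1) u ∧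
      (closure F ∩ Metric.sphere 0 δ).Nonempty ∧ (closure F ∩ Metric.sphere 0 1).Nonempty := by
  obtain ⟨F₁, F₂, -, -, -, hU, h1, h2, -, -, a1, a2, b1, b2⟩ := hA
  rw [← hU] at hx
  rcases hx with hx | hx
  · refine ⟨F₁, hx, ?_, ?_, a1, a2⟩
    · rw [← h1 x hx]; exact isPreconnected_connectedComponentIn
    · rw [← hU]; exact subset_union_left
  · refine ⟨F₂, hx, ?_, ?_, b1, b2⟩
    · rw [← h2 x hx]; exact isPreconnected_connectedComponentIn
    · rw [← hU]; exact subset_union_right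

lemma growth_ii {δ : ℝ} (hδ : 0 < δ) (hδ4 : δ < 1 / 4) {u : ℂ → ℝ}
    (h : IsClassicalSolution (ann δ 1) u) {F : Set ℂ} (hF : IsPreconnected F)
    (hFB : F ⊆ FB (ann δ 1) u)
    (hi : (closure F ∩ Metric.sphere 0 δ).Nonempty) (ho : (closure F ∩ Metric.sphere 0 1).Nonempty)
    {r : ℝ} (hr : 4 * δ < r) (hr1 : r < 1) :
    r / 2 - (2 + 2 * Real.pi * (3 ^ 56 * 2)) / Real.log 2 * (δ * Real.log (1 / δ)) ≤
      2 * Real.pi * sSup (u '' sphere 0 r) := by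
  have hΩ := ann_isOpen δ 1
  have hin : ∀ ρ, δ < ρ → ∃ p ∈ F, dist p 0 < ρ := by
    intro ρ hρ
    obtain ⟨q, hq, hqs⟩ := hi
    have : q ∈ ball (0:ℂ) ρ := by rw [mem_ball, mem_sphere.1 hqs]; exact hρ
    obtain ⟨p, hp1, hp2⟩ := mem_closure_iff.1 hq _ isOpen_ball this
    exact ⟨p, hp2, hp1⟩
  have hou : ∀ ρ, ρ < 1 → ∃ p ∈ F, ρ < dist p 0 := by
    intro ρ hρ
    obtain ⟨q, hq, hqs⟩ := ho
    have hop : IsOpen {z : ℂ | ρ < dist z 0} := isOpen_lt continuous_const (by fun_prop)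
    obtain ⟨p, hp1, hp2⟩ := mem_closure_iff.1 hq _ hop
      (by show ρ < dist q 0; rw [mem_sphere.1 hqs]; exact hρ)
    exact ⟨p, hp2, hp1⟩
  have hsub : ∀ ρ, δ < ρ → ρ < 1 → sphere (0:ℂ) ρ ⊆ ann δ 1 := by
    intro ρ h1 h2 z hz
    rw [mem_sphere, dist_zero_right] at hz
    exact ⟨by rw [hz]; exact h1, by rw [hz]; exact h2⟩
  set R := (r + 1) / 2 with hR
  have hrR : r < R := by rw [hR]; linarith
  have hR1 : R < 1 := by rw [hR]; linarith
  have hr0 : 0 < r := by linarith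
  have hcv : ConvexOn ℝ (Ioo (Real.log (3 / 2 * δ)) (Real.log R)) (fun t : ℝ =>
      (∫ θ in (0:ℝ)..(2 * Real.pi), u (0 + Complex.exp (t + θ * I))) - 1 / 2 * Real.exp t) := by
    apply mean_convex hΩ h (by linarith) (by linarith)
    · intro z h1 h2
      rw [sub_zero] at h1 h2
      exact ⟨by linarith, by linarith⟩
    · intro ρ hρ
      exact cross_zero hΩ h hF hFB (hin ρ (by linarith [hρ.1])) (hou ρ (by linarith [hρ.2]))
    · intro ρ hρ
      exact cross_pos h (by linarith [hρ.1]) (hsub ρ (by linarith [hρ.1]) (by linarith [hρ.2])) hF hFB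
        (hin ρ (by linarith [hρ.1])) (hou ρ (by linarith [hρ.2]))
  set J : ℝ → ℝ := fun t => ∫ θ in (0:ℝ)..(2 * Real.pi), u (0 + Complex.exp (t + θ * I)) with hJ
  have hcb := circle_bound hδ hδ4 h (cross_zero hΩ h hF hFB (hin (2 * δ) (by linarith))
    (hou (2 * δ) (by linarith)))
  have hJ0 : J (Real.log (2 * δ)) ≤ 2 * Real.pi * (3 ^ 56 * (2 * δ)) := by
    apply mean_le h.contOn
    · rw [Real.exp_log (by linarith)]; exact hsub _ (by linarith) (by linarith)
    · rw [Real.exp_log (by linarith)]; exact hcb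
  have hJ1 : 0 ≤ J (Real.log (4 * δ)) := by
    apply mean_nonneg h.nonneg
    rw [Real.exp_log (by linarith)]; exact hsub _ (by linarith) (by linarith)
  have hJT : J (Real.log r) ≤ 2 * Real.pi * sSup (u '' sphere 0 r) :=
    mean_le_sup h.contOn hr0 (hsub r (by linarith) hr1)
  have hl2 : 0 < Real.log 2 := Real.log_pos (by norm_num)
  have e4 : Real.log (4 * δ) = Real.log (2 * δ) + Real.log 2 := by
    rw [← Real.log_mul (by linarith) (by norm_num)]; congr 1; ring
  have hT : Real.log (2 * δ) + Real.log 2 < Real.log r := by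
    rw [← e4]; exact Real.log_lt_log (by linarith) hr
  set D := Real.log r - Real.log (2 * δ) with hD
  have hD0 : Real.log 2 < D := by rw [hD]; linarith
  have hDp : 0 < D := by linarith
  have hDle : D ≤ Real.log (1 / δ) := by
    rw [hD, Real.log_mul (by norm_num) hδ.ne', one_div, Real.log_inv]
    linarith [Real.log_neg hr0 hr1]
  have hx1 : Real.log (2 * δ) ∈ Ioo (Real.log (3 / 2 * δ)) (Real.log R) :=
    ⟨Real.log_lt_log (by linarith) (by linarith), Real.log_lt_log (by linarith) (by linarith)⟩
  have hx2 : Real.log r ∈ Ioo (Real.log (3 / 2 * δ)) (Real.log R) :=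
    ⟨Real.log_lt_log (by linarith) (by linarith), Real.log_lt_log (by linarith) (by linarith)⟩
  set lam := Real.log 2 / D with hlam
  have hlam0 : 0 < lam := by positivity
  have hlam1 : 0 ≤ 1 - lam := by rw [sub_nonneg, hlam, div_le_one hDp]; exact hD0.le
  have hc := hcv.2 hx1 hx2 hlam1 hlam0.le (by ring)
  simp only [smul_eq_mul] at hc
  have e : (1 - lam) * Real.log (2 * δ) + lam * Real.log r = Real.log (4 * δ) := by
    have : lam * D = Real.log 2 := by rw [hlam]; field_simp
    rw [e4, ← this, hD]; ring
  rw [e] at hc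
  have hc' : J (Real.log (4 * δ)) - 1 / 2 * Real.exp (Real.log (4 * δ)) ≤
      (1 - lam) * (J (Real.log (2 * δ)) - 1 / 2 * Real.exp (Real.log (2 * δ))) +
      lam * (J (Real.log r) - 1 / 2 * Real.exp (Real.log r)) := hc
  rw [Real.exp_log (by linarith), Real.exp_log (by linarith), Real.exp_log hr0] at hc'
  set K : ℝ := 2 * Real.pi * (3 ^ 56 * 2) with hK
  have hK0 : 0 < K := by positivity
  have hKδ : 2 * Real.pi * (3 ^ 56 * (2 * δ)) = K * δ := by rw [hK]; ring
  rw [hKδ] at hJ0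
  have h1 : (1 - lam) * (J (Real.log (2 * δ)) - 1 / 2 * (2 * δ)) ≤ K * δ := by
    calc _ ≤ (1 - lam) * (K * δ) := by apply mul_le_mul_of_nonneg_left _ hlam1; linarith
      _ ≤ 1 * (K * δ) := by apply mul_le_mul_of_nonneg_right _ (by positivity); linarith
      _ = _ := one_mul _
  have h2 : -((2 + K) * δ) ≤ lam * (J (Real.log r) - 1 / 2 * r) := by linarith
  have h3 : -((2 + K) * δ) / lam ≤ J (Real.log r) - 1 / 2 * r := by
    rw [div_le_iff₀ hlam0]; linarith
  have h4 : -((2 + K) * δ) / lam = -((2 + K) / Real.log 2 * (δ * D)) := by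
    rw [hlam]; field_simp
  rw [h4] at h3
  have h5 : (2 + K) / Real.log 2 * (δ * D) ≤ (2 + K) / Real.log 2 * (δ * Real.log (1 / δ)) := by
    gcongr
  linarith

/-- non-degeneracy in the punctured annulus under condition (A). -/
theorem nondegeneracy_annulus :
    ∃ c ctil : ℝ, 0 < c ∧ 0 < ctil ∧
    ∀ δ : ℝ, 0 < δ → δ < 1 / 4 →
    ∀ u : ℂ → ℝ, IsClassicalSolution (ann δ 1) u → ConditionA δ 1 u →
      -- (i) growth away from free boundary points
      (∀ x₀ ∈ FB (ann δ 1) u, ∀ r : ℝ, 0 < r →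
        r < sSup {s : ℝ | Metric.ball x₀ s ⊆ ann δ 1} →
        sSup (u '' Metric.ball x₀ r) = sSup (u '' Metric.sphere x₀ r) ∧
        r / (4 * Real.pi) ≤ sSup (u '' Metric.sphere x₀ r)) ∧
      -- (ii) growth away from the center of the annulus
      (∀ r : ℝ, ctil * (δ * Real.log (1 / δ)) < r → r < 1 →
        c * r ≤ sSup (u '' Metric.sphere 0 r)) := by
  have hl2 : 0 < Real.log 2 := Real.log_pos (by norm_num)
  set C : ℝ := (2 + 2 * Real.pi * (3 ^ 56 * 2)) / Real.log 2 with hC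
  have hC0 : 0 < C := by positivity
  refine ⟨1 / (8 * Real.pi), 4 * C + 4, by positivity, by positivity, ?_⟩
  intro δ hδ hδ4 u h hA
  have hΩ := ann_isOpen δ 1
  refine ⟨?_, ?_⟩
  · intro x₀ hx₀ r hr hrs
    obtain ⟨s, hs, hrs'⟩ := exists_lt_of_lt_csSup
      (⟨0, by simp⟩ : {s : ℝ | Metric.ball x₀ s ⊆ ann δ 1}.Nonempty) hrs
    have hs : ball x₀ s ⊆ ann δ 1 := hs
    set R := (r + s) / 2 with hR
    have hrR : r < R := by rw [hR]; linarith
    have hRs : R < s := by rw [hR]; linarith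
    obtain ⟨F, hxF, hF, hFB, -, q, hq, hq1⟩ := condA_comp hA hx₀
    have hbR : closedBall x₀ R ⊆ ann δ 1 := (closedBall_subset_ball hRs).trans hs
    refine ⟨sSup_ball_eq hΩ h hr ((closedBall_subset_closedBall hrR.le).trans hbR), ?_⟩
    apply growth_i hΩ h hr hrR hbR hF hFB hxF
    have hqs : R < dist q x₀ := by
      by_contra! hle
      have := (hbR (mem_closedBall.2 hle)).2
      rw [mem_sphere, dist_zero_right] at hq1
      linarith
    have hop : IsOpen {z : ℂ | R < dist z x₀} := isOpen_lt continuous_const (by fun_prop)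
    obtain ⟨p, hp1, hp2⟩ := mem_closure_iff.1 hq _ hop hqs
    exact ⟨p, hp2, hp1⟩
  · intro r hr hr1
    have hne : ∃ x, x ∈ FB (ann δ 1) u := by
      obtain ⟨F₁, F₂, ⟨x, hx⟩, -, -, hU, -⟩ := hA
      exact ⟨x, by rw [← hU]; exact Or.inl hx⟩
    obtain ⟨x, hx⟩ := hne
    obtain ⟨F, -, hF, hFB, hi, ho⟩ := condA_comp hA hx
    have hlog : 1 ≤ Real.log (1 / δ) := by
      rw [Real.le_log_iff_exp_le (by positivity)]
      have h1 : Real.exp 1 < 4 := by linarith [Real.exp_one_lt_d9]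
      have h2 : (4:ℝ) ≤ 1 / δ := by rw [le_div_iff₀ hδ]; linarith
      linarith
    have hL : δ ≤ δ * Real.log (1 / δ) := by nlinarith
    set L := δ * Real.log (1 / δ) with hLd
    have hCL : 0 < C * L := mul_pos hC0 (by linarith)
    have hg := growth_ii hδ hδ4 h hF hFB hi ho (r := r) (by nlinarith) hr1
    rw [← hC, ← hLd] at hg
    rw [one_div_mul_eq_div, div_le_iff₀ (by positivity)]
    nlinarith
end

section
/- Let S = {ζ ∈ ℂ : |Im ζ| < π/2} and φ(ζ) = ζ + sinh ζ. Then φ is injective on S, and the image φ(S) equals Ω₁ = {x₁ + ix₂ ∈ ℂ : |x₂| < π/2 + cosh x₁}; consequently φ restricted to S is a biholomorphism of S onto the open set Ω₁. -/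
open Complex Metric Set Filter MeasureTheory
open scoped Topology Classical NNReal

lemma aux_re (z : ℂ) : (z + Complex.sinh z).re = z.re + Real.sinh z.re * Real.cos z.im := by
  have h : Complex.sinh z = Complex.sinh (z.re + z.im * Complex.I) := by rw [Complex.re_add_im]
  rw [h, Complex.sinh_add, Complex.sinh_mul_I, Complex.cosh_mul_I]
  simp [← Complex.ofReal_sinh, ← Complex.ofReal_cosh, ← Complex.ofReal_sin, ← Complex.ofReal_cos]

lemma aux_im (z : ℂ) : (z + Complex.sinh z).im = z.im + Real.cosh z.re * Real.sin z.im := by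
  have h : Complex.sinh z = Complex.sinh (z.re + z.im * Complex.I) := by rw [Complex.re_add_im]
  rw [h, Complex.sinh_add, Complex.sinh_mul_I, Complex.cosh_mul_I]
  simp [← Complex.ofReal_sinh, ← Complex.ofReal_cosh, ← Complex.ofReal_sin, ← Complex.ofReal_cos]

lemma aux_cosh_re (z : ℂ) : (Complex.cosh z).re = Real.cosh z.re * Real.cos z.im := by
  have h : Complex.cosh z = Complex.cosh (z.re + z.im * Complex.I) := by rw [Complex.re_add_im]
  rw [h, Complex.cosh_add, Complex.sinh_mul_I, Complex.cosh_mul_I]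
  simp [← Complex.ofReal_sinh, ← Complex.ofReal_cosh, ← Complex.ofReal_sin, ← Complex.ofReal_cos]

lemma aux_deriv_pos {z : ℂ} (hz : z ∈ Sstrip) : 0 < (1 + Complex.cosh z).re := by
  have h := abs_lt.1 (show |z.im| < Real.pi / 2 from hz)
  have hc := Real.cos_pos_of_mem_Ioo ⟨by linarith [h.1], h.2⟩
  have := mul_pos (Real.cosh_pos z.re) hc
  rw [Complex.add_re, aux_cosh_re, Complex.one_re]; linarith

lemma aux_hasDeriv (z : ℂ) :
    HasStrictDerivAt (fun ζ : ℂ => ζ + Complex.sinh ζ) (1 + Complex.cosh z) z :=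
  (hasStrictDerivAt_id z).add (Complex.hasStrictDerivAt_sinh z)

lemma aux_convex : Convex ℝ Sstrip := by
  have : Sstrip = Complex.imLm ⁻¹' (Set.Ioo (-(Real.pi/2)) (Real.pi/2)) := by
    ext z; simp [Sstrip, abs_lt]
  rw [this]
  exact (convex_Ioo _ _).linear_preimage _

lemma aux_inj : Set.InjOn (fun ζ : ℂ => ζ + Complex.sinh ζ) Sstrip := by
  intro z hz w hw h
  by_contra hne
  have hd : w - z ≠ 0 := sub_ne_zero.2 (Ne.symm hne)
  set L : ℝ → ℂ := fun t => z + t * (w - z) with hL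
  have hmem : ∀ t ∈ Set.Icc (0:ℝ) 1, L t ∈ Sstrip := by
    intro t ht
    have := aux_convex.add_smul_sub_mem hz hw ht
    simpa [hL] using this
  have hLd : ∀ t, HasDerivAt L (w - z) t := by
    intro t
    have := ((Complex.ofRealCLM.hasDerivAt (x := t)).mul_const (w - z)).const_add z
    simpa [hL] using this
  let g : ℝ → ℝ := fun t => ((starRingEnd ℂ) (w - z) * (L t + Complex.sinh (L t))).re
  have hg : ∀ t, HasDerivAt g
      (((starRingEnd ℂ) (w - z) * ((1 + Complex.cosh (L t)) * (w - z))).re) t := by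
    intro t
    have h1 := ((aux_hasDeriv (L t)).hasDerivAt.comp t (hLd t)).const_mul
      ((starRingEnd ℂ) (w - z))
    exact Complex.reCLM.hasFDerivAt.comp_hasDerivAt t h1
  have hcont : ContinuousOn g (Set.Icc 0 1) :=
    fun t _ => (hg t).continuousAt.continuousWithinAt
  obtain ⟨c, hc, hcs⟩ := exists_hasDerivAt_eq_slope g _ zero_lt_one hcont (fun t _ => hg t)
  have h0 : g 1 = g 0 := by
    have : w + Complex.sinh w = z + Complex.sinh z := h.symm
    have l1 : L 1 = w := by simp [hL]
    have l0 : L 0 = z := by simp [hL]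
    simp only [g, l1, l0, this]
  have h2 : (starRingEnd ℂ) (w - z) * ((1 + Complex.cosh (L c)) * (w - z))
      = ((Complex.normSq (w - z) : ℝ) : ℂ) * (1 + Complex.cosh (L c)) := by
    rw [Complex.normSq_eq_conj_mul_self]; ring
  rw [h0, h2, Complex.re_ofReal_mul] at hcs
  have := mul_pos (Complex.normSq_pos.2 hd) (aux_deriv_pos (hmem c ⟨hc.1.le, hc.2.le⟩))
  simp only [sub_self, zero_div] at hcs
  linarith

lemma aux_cosh_le (a c : ℝ) (hc : 0 ≤ c) :
    Real.cosh a ≤ Real.cosh (a + Real.sinh a * c) := by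
  rw [Real.cosh_le_cosh]
  rcases le_total 0 a with h | h
  · have := mul_nonneg (Real.sinh_nonneg_iff.2 h) hc
    rw [abs_of_nonneg h, abs_of_nonneg (by linarith)]; linarith
  · have := mul_nonneg (neg_nonneg.2 (Real.sinh_nonpos_iff.2 h)) hc
    rw [abs_of_nonpos h, abs_of_nonpos (by linarith)]; linarith

lemma aux_maps {z : ℂ} (hz : z ∈ Sstrip) : z + Complex.sinh z ∈ Omega1 := by
  have h : |z.im| < Real.pi / 2 := hz
  have h' := abs_lt.1 h
  have hc := Real.cos_pos_of_mem_Ioo ⟨by linarith [h'.1], h'.2⟩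
  show |(z + Complex.sinh z).im| < Real.pi / 2 + Real.cosh (z + Complex.sinh z).re
  rw [aux_re, aux_im]
  have h1 := aux_cosh_le z.re _ hc.le
  have h2 : |Real.cosh z.re * Real.sin z.im| ≤ Real.cosh z.re := by
    rw [abs_mul, abs_of_pos (Real.cosh_pos _)]
    exact mul_le_of_le_one_right (Real.cosh_pos _).le (Real.abs_sin_le_one _)
  have h3 := abs_add_le z.im (Real.cosh z.re * Real.sin z.im)
  linarith

lemma aux_exists (x c : ℝ) (hc : 0 ≤ c) : ∃ a : ℝ, a + Real.sinh a * c = x := by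
  have hcont : Continuous fun a : ℝ => a + Real.sinh a * c := by
    have := Real.continuous_sinh
    fun_prop
  have h1 := mul_nonneg (Real.sinh_nonneg_iff.2 (abs_nonneg x)) hc
  have := intermediate_value_Icc (a := -|x|) (b := |x|) (by linarith [abs_nonneg x])
    hcont.continuousOn
  obtain ⟨a, -, ha⟩ := this (show x ∈ _ by
    constructor
    · have := neg_abs_le x
      simp only [Real.sinh_neg]; linarith
    · have := le_abs_self x
      linarith)
  exact ⟨a, ha⟩

lemma aux_lip {x a₁ a₂ c₁ c₂ : ℝ} (hc : 0 ≤ c₁) (h1 : a₁ + Real.sinh a₁ * c₁ = x)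
    (h2 : a₂ + Real.sinh a₂ * c₂ = x) : |a₁ - a₂| ≤ |Real.sinh a₂| * |c₁ - c₂| := by
  have key : (a₁ - a₂) + c₁ * (Real.sinh a₁ - Real.sinh a₂) = Real.sinh a₂ * (c₂ - c₁) := by
    linarith
  rw [abs_sub_comm c₁, ← abs_mul, ← key]
  rcases le_total a₂ a₁ with h | h
  · have := mul_nonneg hc (sub_nonneg.2 (Real.sinh_le_sinh.2 h))
    rw [abs_of_nonneg (by linarith), abs_of_nonneg (by linarith)]; linarith
  · have := mul_nonneg hc (sub_nonneg.2 (Real.sinh_le_sinh.2 h))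
    rw [abs_of_nonpos (by linarith), abs_of_nonpos (by linarith)]; linarith

lemma aux_surj {z : ℂ} (hz : z ∈ Omega1) : ∃ w ∈ Sstrip, w + Complex.sinh w = z := by
  have hz' := abs_lt.1 (show |z.im| < Real.pi / 2 + Real.cosh z.re from hz)
  choose A hA using fun b : ℝ => aux_exists z.re |Real.cos b| (abs_nonneg _)
  have hAc : Continuous A := by
    rw [continuous_iff_continuousAt]
    intro b
    rw [ContinuousAt, tendsto_iff_dist_tendsto_zero]
    refine squeeze_zero (fun _ => dist_nonneg)
      (fun t => aux_lip (abs_nonneg _) (hA t) (hA b)) ?_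
    have : Continuous fun t => |Real.sinh (A b)| * |(|Real.cos t| - |Real.cos b|)| := by fun_prop
    simpa using this.tendsto b
  have hF : Continuous fun b => b + Real.cosh (A b) * Real.sin b := by
    have := Real.continuous_cosh
    fun_prop
  have hp := Real.pi_pos
  have e1 : A (Real.pi / 2) = z.re := by have := hA (Real.pi / 2); simpa using this
  have e2 : A (-(Real.pi / 2)) = z.re := by have := hA (-(Real.pi / 2)); simpa using this
  have := intermediate_value_Ioo (a := -(Real.pi / 2)) (b := Real.pi / 2) (by linarith)
    hF.continuousOn
  obtain ⟨b, hb, hby⟩ := this (show z.im ∈ _ by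
    simp only [e1, e2, Real.sin_neg, Real.sin_pi_div_two]
    constructor <;> linarith)
  have hcos := Real.cos_pos_of_mem_Ioo hb
  refine ⟨⟨A b, b⟩, abs_lt.2 hb, Complex.ext ?_ ?_⟩
  · rw [aux_re]
    have := hA b
    rwa [abs_of_pos hcos] at this
  · rw [aux_im]; exact hby

/-- `φ(ζ) = ζ + sinh ζ` is a biholomorphism of the strip
`S = {|Im ζ| < π/2}` onto `Ω₁ = {|x₂| < π/2 + cosh x₁}`. -/
theorem strip_biholomorphism :
    Set.InjOn (fun ζ : ℂ => ζ + Complex.sinh ζ) Sstrip ∧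
    (fun ζ : ℂ => ζ + Complex.sinh ζ) '' Sstrip = Omega1 ∧
    IsOpen Omega1 ∧
    ∃ ψ : ℂ → ℂ, DifferentiableOn ℂ ψ Omega1 ∧ Set.MapsTo ψ Omega1 Sstrip ∧
      (∀ z ∈ Omega1, ψ z + Complex.sinh (ψ z) = z) ∧
      (∀ w ∈ Sstrip, ψ (w + Complex.sinh w) = w) := by
  have himg : (fun ζ : ℂ => ζ + Complex.sinh ζ) '' Sstrip = Omega1 := by
    ext z
    constructor
    · rintro ⟨w, hw, rfl⟩; exact aux_maps hw
    · intro hz; exact aux_surj hz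
  have hSo : IsOpen Sstrip := isOpen_lt (by fun_prop) continuous_const
  have hOo : IsOpen Omega1 := isOpen_lt (by fun_prop)
    (continuous_const.add (Real.continuous_cosh.comp Complex.continuous_re))
  refine ⟨aux_inj, himg, hOo, Function.invFunOn (fun ζ : ℂ => ζ + Complex.sinh ζ) Sstrip, ?_⟩
  have hleft : ∀ w ∈ Sstrip,
      Function.invFunOn (fun ζ : ℂ => ζ + Complex.sinh ζ) Sstrip (w + Complex.sinh w) = w :=
    fun w hw => aux_inj.leftInvOn_invFunOn hw
  refine ⟨?_, ?_, ?_, hleft⟩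
  · intro z hz
    obtain ⟨w, hw, rfl⟩ := aux_surj hz
    have hne : 1 + Complex.cosh w ≠ 0 := by
      intro h0
      have := aux_deriv_pos hw
      rw [h0] at this
      simp at this
    exact ((aux_hasDeriv w).to_local_left_inverse hne
      (Filter.mem_of_superset (hSo.mem_nhds hw) hleft)).hasDerivAt.differentiableAt.differentiableWithinAt
  · intro z hz
    obtain ⟨w, hw, rfl⟩ := aux_surj hz
    rw [hleft w hw]; exact hw
  · intro z hz
    obtain ⟨w, hw, rfl⟩ := aux_surj hz
    rw [hleft w hw]
end

section
/- Let S = {ζ ∈ ℂ : |Im ζ| < π/2}, φ(ζ) = ζ + sinh ζ, and Ω₁ = {x₁ + ix₂ ∈ ℂ : |x₂| < π/2 + cosh x₁}, and define H : ℂ → ℝ by H(z) = Re(cosh w) for z ∈ Ω₁, where w is the unique point of S with φ(w) = z, and H(z) = 0 for z ∉ Ω₁. Then H is well-defined and continuous on ℂ, H > 0 on Ω₁, H is harmonic on Ω₁, and the gradient ∇H of H restricted to Ω₁ extends continuously to the closure of Ω₁ with |∇H(z)| = 1 for every z ∈ ∂Ω₁. In particular, H is an entire classical solution of the one-phase free boundary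 problem (the double hairpin solution of Hauswirth–Hélein–Pacard). -/
open Complex Metric Set Filter MeasureTheory
open scoped Topology Classical NNReal

noncomputable def hpP (w : ℂ) : ℂ := w + Complex.sinh w

def hpT : Set ℂ := {w : ℂ | |w.im| ≤ Real.pi / 2}

def hpK : Set ℂ := {z : ℂ | |z.im| ≤ Real.pi / 2 + Real.cosh z.re}

lemma hp_cosh_re (w : ℂ) : (Complex.cosh w).re = Real.cosh w.re * Real.cos w.im := by
  conv_lhs => rw [← Complex.re_add_im w, Complex.cosh_add, Complex.cosh_mul_I, Complex.sinh_mul_I]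
  simp
  exact Or.inl rfl

lemma hp_cosh_im (w : ℂ) : (Complex.cosh w).im = Real.sinh w.re * Real.sin w.im := by
  conv_lhs => rw [← Complex.re_add_im w, Complex.cosh_add, Complex.cosh_mul_I, Complex.sinh_mul_I]
  simp
  rfl

lemma hp_sinh_re (w : ℂ) : (Complex.sinh w).re = Real.sinh w.re * Real.cos w.im := by
  conv_lhs => rw [← Complex.re_add_im w, Complex.sinh_add, Complex.cosh_mul_I, Complex.sinh_mul_I]
  simp
  rfl

lemma hp_sinh_im (w : ℂ) : (Complex.sinh w).im = Real.cosh w.re * Real.sin w.im := by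
  conv_lhs => rw [← Complex.re_add_im w, Complex.sinh_add, Complex.cosh_mul_I, Complex.sinh_mul_I]
  simp
  exact Or.inl rfl

lemma hpP_re (w : ℂ) : (hpP w).re = w.re + Real.sinh w.re * Real.cos w.im := by
  simp [hpP, hp_sinh_re]

lemma hpP_im (w : ℂ) : (hpP w).im = w.im + Real.cosh w.re * Real.sin w.im := by
  simp [hpP, hp_sinh_im]

lemma hp_cos_nonneg {w : ℂ} (hw : w ∈ hpT) : 0 ≤ Real.cos w.im := by
  have := abs_le.1 (show |w.im| ≤ Real.pi / 2 from hw)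
  exact Real.cos_nonneg_of_neg_pi_div_two_le_of_le (by linarith) this.2

lemma hp_cos_pos {w : ℂ} (hw : w ∈ Sstrip) : 0 < Real.cos w.im := by
  have := abs_lt.1 (show |w.im| < Real.pi / 2 from hw)
  exact Real.cos_pos_of_mem_Ioo ⟨by linarith, this.2⟩

lemma hp_deriv (w : ℂ) : HasDerivAt hpP (1 + Complex.cosh w) w :=
  (hasDerivAt_id w).add (Complex.hasDerivAt_sinh w)

lemma hp_deriv_re {w : ℂ} (hw : w ∈ hpT) : 1 ≤ (1 + Complex.cosh w).re := by
  have := mul_nonneg (Real.cosh_pos w.re).le (hp_cos_nonneg hw)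
  simp [hp_cosh_re, this]

lemma hp_deriv_ne {w : ℂ} (hw : w ∈ hpT) : 1 + Complex.cosh w ≠ 0 := by
  intro h
  have := hp_deriv_re hw
  rw [h] at this
  norm_num at this

lemma hpS_sub_T : Sstrip ⊆ hpT := fun w hw => le_of_lt (show |w.im| < Real.pi / 2 from hw)

lemma hpT_convex : Convex ℝ hpT := by
  have : hpT = Complex.imCLM ⁻¹' (Icc (-(Real.pi/2)) (Real.pi/2)) := by
    ext w; simp [hpT, abs_le]
  rw [this]
  exact (convex_Icc _ _).linear_preimage Complex.imCLM.toLinearMap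

lemma hpT_closed : IsClosed hpT :=
  isClosed_le (by fun_prop) (by fun_prop)

lemma hpS_open : IsOpen Sstrip :=
  isOpen_lt (by fun_prop) (by fun_prop)

lemma hpP_cont : Continuous hpP := by
  unfold hpP; fun_prop

/-- The map is expanding on the closed strip. -/
lemma hp_expand {a b : ℂ} (ha : a ∈ hpT) (hb : b ∈ hpT) : ‖b - a‖ ≤ ‖hpP b - hpP a‖ := by
  set d := b - a with hd
  let g : ℝ → ℝ := fun t => (hpP (a + t * d) * (starRingEnd ℂ) d).re
  let g' : ℝ → ℝ := fun t => ((1 + Complex.cosh (a + t * d)) * d * (starRingEnd ℂ) d).re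
  have hg : ∀ t, HasDerivAt g (g' t) t := by
    intro t
    have h1 : HasDerivAt (fun s : ℂ => a + s * d) d (t : ℂ) := by
      simpa using ((hasDerivAt_id (t : ℂ)).mul_const d).const_add a
    have h2 := ((hp_deriv (a + t * d)).comp (t : ℂ) h1).mul_const ((starRingEnd ℂ) d)
    exact h2.real_of_complex
  obtain ⟨c, hc, hc'⟩ := exists_hasDerivAt_eq_slope g g' (zero_lt_one)
    (fun t _ => (hg t).continuousAt.continuousWithinAt) (fun t _ => hg t)
  have hmem : a + c * d ∈ hpT := by
    have := hpT_convex.add_smul_sub_mem ha hb (t := c) ⟨hc.1.le, hc.2.le⟩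
    simpa [hd] using this
  have h3 : ‖d‖ ^ 2 ≤ g' c := by
    have h4 := hp_deriv_re hmem
    have : g' c = (1 + Complex.cosh (a + c * d)).re * ‖d‖ ^ 2 := by
      simp only [g', mul_assoc, Complex.mul_conj, Complex.normSq_eq_norm_sq]
      rw [Complex.re_mul_ofReal]
    rw [this]
    nlinarith [sq_nonneg ‖d‖]
  have h5 : g 1 - g 0 = ((hpP b - hpP a) * (starRingEnd ℂ) d).re := by
    simp only [g, ← Complex.sub_re, ← sub_mul]
    simp [hd]
  have h6 : ((hpP b - hpP a) * (starRingEnd ℂ) d).re ≤ ‖hpP b - hpP a‖ * ‖d‖ := by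
    refine (Complex.re_le_norm _).trans ?_
    simp
  have h7 : ‖d‖ ^ 2 ≤ ‖hpP b - hpP a‖ * ‖d‖ := by
    rw [hc'] at h3
    simp only [sub_zero, div_one, h5] at h3
    exact h3.trans h6
  rcases (norm_nonneg d).eq_or_lt with h | h
  · rw [← h]; positivity
  · rw [sq] at h7; exact le_of_mul_le_mul_right h7 h

lemma hp_inj : InjOn hpP hpT := by
  intro a ha b hb h
  have := hp_expand ha hb
  rw [h, sub_self, norm_zero, norm_le_zero_iff, sub_eq_zero] at this
  exact this.symm

lemma hp_cosh_le {w : ℂ} (hw : w ∈ hpT) : Real.cosh w.re ≤ Real.cosh (hpP w).re := by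
  rw [Real.cosh_le_cosh, hpP_re]
  have hc := hp_cos_nonneg hw
  rcases le_total 0 w.re with h | h
  · have : 0 ≤ Real.sinh w.re := Real.sinh_nonneg_iff.2 h
    have := mul_nonneg this hc
    rw [abs_of_nonneg h, abs_of_nonneg (by linarith)]; linarith
  · have : Real.sinh w.re ≤ 0 := Real.sinh_nonpos_iff.2 h
    have := mul_nonpos_of_nonpos_of_nonneg this hc
    rw [abs_of_nonpos h, abs_of_nonpos (by linarith)]; linarith

lemma hp_maps {w : ℂ} (hw : w ∈ Sstrip) : hpP w ∈ Omega1 := by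
  have h1 := hp_cosh_le (hpS_sub_T hw)
  have hw' : |w.im| < Real.pi / 2 := hw
  show |(hpP w).im| < Real.pi / 2 + Real.cosh (hpP w).re
  rw [hpP_im]
  have h2 : |Real.cosh w.re * Real.sin w.im| ≤ Real.cosh w.re := by
    rw [abs_mul, abs_of_pos (Real.cosh_pos _)]
    exact mul_le_of_le_one_right (Real.cosh_pos _).le (Real.abs_sin_le_one _)
  have := abs_add_le w.im (Real.cosh w.re * Real.sin w.im)
  linarith

lemma hp_bdry {w : ℂ} (hw : |w.im| = Real.pi / 2) :
    Real.cos w.im = 0 ∧ (hpP w).re = w.re ∧ |(hpP w).im| = Real.pi / 2 + Real.cosh w.re := by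
  have hp := Real.pi_pos
  have hcp := Real.cosh_pos w.re
  rw [hpP_re, hpP_im]
  rcases (abs_eq (by positivity)).1 hw with h | h <;> rw [h]
  · refine ⟨by simp, by simp, ?_⟩
    rw [Real.sin_pi_div_two, abs_of_pos (by linarith)]; ring
  · refine ⟨by simp, by simp, ?_⟩
    rw [Real.sin_neg, Real.sin_pi_div_two, abs_of_neg (by linarith)]; ring

lemma hp_mem_S_of {w : ℂ} (hw : w ∈ hpT) (h : hpP w ∈ Omega1) : w ∈ Sstrip := by
  by_contra hn
  have : |w.im| = Real.pi / 2 := le_antisymm hw (not_lt.1 hn)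
  obtain ⟨_, h1, h2⟩ := hp_bdry this
  have h3 : |(hpP w).im| < Real.pi / 2 + Real.cosh (hpP w).re := h
  rw [h1, h2] at h3
  exact lt_irrefl _ h3

lemma hp_Omega_open : IsOpen Omega1 :=
  isOpen_lt (by fun_prop) (by fun_prop)

lemma hpK_closed : IsClosed hpK :=
  isClosed_le (by fun_prop) (by fun_prop)

lemma hp_Omega_preconn : IsPreconnected Omega1 := by
  let f : ℝ × ℝ → ℂ := fun p => (p.1 : ℂ) + ((p.2 * (Real.pi / 2 + Real.cosh p.1) : ℝ) : ℂ) * I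
  have hf : Continuous f := by fun_prop
  have : Omega1 = f '' (univ ×ˢ Ioo (-1) 1) := by
    ext z
    have hpos : 0 < Real.pi / 2 + Real.cosh z.re := by
      have := Real.pi_pos; have := Real.cosh_pos z.re; positivity
    constructor
    · intro hz
      have hz' : |z.im| < Real.pi / 2 + Real.cosh z.re := hz
      refine ⟨(z.re, z.im / (Real.pi / 2 + Real.cosh z.re)), ⟨trivial, ?_⟩, ?_⟩
      · show _ < _ ∧ _ < _
        rw [← abs_lt, abs_div, abs_of_pos hpos, div_lt_one hpos]; exact hz'
      · simp only [f]
        rw [div_mul_cancel₀ _ hpos.ne', Complex.re_add_im]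
    · rintro ⟨⟨x, t⟩, ⟨-, ht⟩, rfl⟩
      have ht' : |t| < 1 := abs_lt.2 ht
      have hx : 0 < Real.pi / 2 + Real.cosh x := by
        have := Real.pi_pos; have := Real.cosh_pos x; positivity
      have e1 : (f (x, t)).re = x := by simp only [f]; rw [Complex.add_re, Complex.re_ofReal_mul]; simp
      have e2 : (f (x, t)).im = t * (Real.pi / 2 + Real.cosh x) := by
        simp only [f]; rw [Complex.add_im, Complex.im_ofReal_mul]; simp
      show |(f (x, t)).im| < Real.pi / 2 + Real.cosh (f (x, t)).re
      rw [e1, e2, abs_mul, abs_of_pos hx]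
      nlinarith
  rw [this]
  exact (isPreconnected_univ.prod isPreconnected_Ioo).image _ hf.continuousOn

lemma hp_image_closed : IsClosed (hpP '' hpT) := by
  rw [← isSeqClosed_iff_isClosed]
  intro x z hx hz
  choose w hw hwx using hx
  have hc : CauchySeq w := by
    have := hz.cauchySeq
    rw [Metric.cauchySeq_iff] at this ⊢
    intro ε hε
    obtain ⟨N, hN⟩ := this ε hε
    refine ⟨N, fun m hm n hn => lt_of_le_of_lt ?_ (hN m hm n hn)⟩
    rw [dist_eq_norm, dist_eq_norm, ← hwx, ← hwx]
    exact hp_expand (hw n) (hw m)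
  obtain ⟨w0, hw0⟩ := cauchySeq_tendsto_of_complete hc
  refine ⟨w0, hpT_closed.mem_of_tendsto hw0 (Eventually.of_forall hw), ?_⟩
  refine tendsto_nhds_unique ((hpP_cont.tendsto w0).comp hw0) ?_
  exact hz.congr fun n => (hwx n).symm

lemma hp_strict (w : ℂ) : HasStrictDerivAt hpP (1 + Complex.cosh w) w :=
  (hasStrictDerivAt_id w).add (Complex.hasStrictDerivAt_sinh w)

lemma hp_analytic (w : ℂ) : AnalyticAt ℂ hpP w := by
  have : Differentiable ℂ hpP := fun w => (hp_deriv w).differentiableAt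
  exact this.analyticAt w

lemma hp_image_open : IsOpen (hpP '' Sstrip) := by
  rw [isOpen_iff_mem_nhds]
  rintro _ ⟨w, hw, rfl⟩
  rw [← (hp_strict w).map_nhds_eq (hp_deriv_ne (hpS_sub_T hw))]
  exact image_mem_map (hpS_open.mem_nhds hw)

lemma hp_surj : Omega1 ⊆ hpP '' Sstrip := by
  have h0 : (0 : ℂ) ∈ Sstrip := by
    show |(0 : ℂ).im| < Real.pi / 2
    simp [Real.pi_pos]
  refine hp_Omega_preconn.subset_of_closure_inter_subset hp_image_open
    ⟨hpP 0, hp_maps h0, 0, h0, rfl⟩ ?_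
  rintro z ⟨hz, hz'⟩
  obtain ⟨w, hw, rfl⟩ := closure_minimal (image_mono hpS_sub_T) hp_image_closed hz
  exact ⟨w, hp_mem_S_of hw hz', rfl⟩

lemma hp_surjT : hpK ⊆ hpP '' hpT := by
  intro z hz
  rcases lt_or_eq_of_le (show |z.im| ≤ Real.pi / 2 + Real.cosh z.re from hz) with h | h
  · exact image_mono hpS_sub_T (hp_surj h)
  · have hp := Real.pi_pos
    have hcp := Real.cosh_pos z.re
    rcases (abs_eq (by positivity)).1 h with h | h
    · refine ⟨⟨z.re, Real.pi / 2⟩, ?_, ?_⟩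
      · show |Real.pi / 2| ≤ _
        rw [abs_of_pos (by positivity)]
      · apply Complex.ext
        · rw [hpP_re]; simp
        · rw [hpP_im, h]; simp
    · refine ⟨⟨z.re, -(Real.pi / 2)⟩, ?_, ?_⟩
      · show |-(Real.pi / 2)| ≤ _
        rw [abs_neg, abs_of_pos (by positivity)]
      · apply Complex.ext
        · rw [hpP_re]; simp
        · rw [hpP_im, h]; simp; ring

lemma hp_closure : closure Omega1 = hpK := by
  apply Subset.antisymm
  · exact closure_minimal (fun z hz => le_of_lt (show |z.im| < Real.pi / 2 + Real.cosh z.re from hz)) hpK_closed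
  · intro z hz
    have hz' : |z.im| ≤ Real.pi / 2 + Real.cosh z.re := hz
    have hpos : 0 < Real.pi / 2 + Real.cosh z.re := by
      have := Real.pi_pos; have := Real.cosh_pos z.re; positivity
    have hcont : Continuous (fun t : ℝ => (⟨z.re, t * z.im⟩ : ℂ)) := by
      have : (fun t : ℝ => (⟨z.re, t * z.im⟩ : ℂ)) =
          fun t : ℝ => (z.re : ℂ) + ((t * z.im : ℝ) : ℂ) * I := by
        ext t; rw [Complex.mk_eq_add_mul_I]
      rw [this]; fun_prop
    have h1 : (1 : ℝ) ∈ closure (Ico (0 : ℝ) 1) := by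
      rw [closure_Ico (by norm_num)]; simp
    have := map_mem_closure hcont h1 (t := Omega1) ?_
    · simpa using this
    · intro t ht
      show |t * z.im| < Real.pi / 2 + Real.cosh z.re
      rw [abs_mul, abs_of_nonneg ht.1]
      nlinarith [ht.1, ht.2, abs_nonneg z.im]

lemma hp_frontier : frontier Omega1 = {z : ℂ | |z.im| = Real.pi / 2 + Real.cosh z.re} := by
  rw [hp_Omega_open.frontier_eq, hp_closure]
  ext z
  show (|z.im| ≤ _ ∧ ¬ (|z.im| < _)) ↔ |z.im| = _
  rw [not_lt]
  exact ⟨fun h => le_antisymm h.1 h.2, fun h => ⟨h.le, h.ge⟩⟩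

noncomputable def hpPsi : ℂ → ℂ := Function.invFunOn hpP hpT

lemma hpPsi_mem {z : ℂ} (hz : z ∈ hpK) : hpPsi z ∈ hpT :=
  Function.invFunOn_mem (hp_surjT hz)

lemma hpPsi_eq {z : ℂ} (hz : z ∈ hpK) : hpP (hpPsi z) = z :=
  Function.invFunOn_eq (hp_surjT hz)

lemma hp_Omega_sub : Omega1 ⊆ hpK := by
  rw [← hp_closure]; exact subset_closure

lemma hpPsi_memS {z : ℂ} (hz : z ∈ Omega1) : hpPsi z ∈ Sstrip :=
  hp_mem_S_of (hpPsi_mem (hp_Omega_sub hz)) (by rwa [hpPsi_eq (hp_Omega_sub hz)])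

lemma hpPsi_unique {z w : ℂ} (hz : z ∈ hpK) (hw : w ∈ hpT) (h : hpP w = z) : hpPsi z = w :=
  hp_inj (hpPsi_mem hz) hw (by rw [hpPsi_eq hz, h])

lemma hpPsi_cont : ContinuousOn hpPsi hpK := by
  have : LipschitzOnWith 1 hpPsi hpK := by
    apply LipschitzOnWith.of_dist_le_mul
    intro x hx y hy
    have := hp_expand (hpPsi_mem hy) (hpPsi_mem hx)
    rw [hpPsi_eq hx, hpPsi_eq hy] at this
    simpa [dist_eq_norm] using this
  exact this.continuousOn

lemma hpPsi_bdry {z : ℂ} (hz : z ∈ hpK) (hz' : z ∉ Omega1) : |(hpPsi z).im| = Real.pi / 2 := by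
  refine le_antisymm (hpPsi_mem hz) (not_lt.1 fun h => hz' ?_)
  rw [← hpPsi_eq hz]
  exact hp_maps h

lemma hpH_zero {z : ℂ} (hz : z ∉ Omega1) : hairpinH z = 0 := by
  unfold hairpinH
  rw [dif_neg]
  rintro ⟨w, hw, rfl⟩
  exact hz (hp_maps hw)

lemma hpH_eq {z : ℂ} (hz : z ∈ hpK) : hairpinH z = (Complex.cosh (hpPsi z)).re := by
  by_cases h : z ∈ Omega1
  · have hex : ∃ w : ℂ, w ∈ Sstrip ∧ w + Complex.sinh w = z := by
      obtain ⟨w, hw, h⟩ := hp_surj h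
      exact ⟨w, hw, h⟩
    unfold hairpinH
    rw [dif_pos hex, hpPsi_unique hz (hpS_sub_T hex.choose_spec.1) hex.choose_spec.2]
  · rw [hpH_zero h, hp_cosh_re, (hp_bdry (hpPsi_bdry hz h)).1, mul_zero]

lemma hpH_pos {z : ℂ} (hz : z ∈ Omega1) : 0 < hairpinH z := by
  rw [hpH_eq (hp_Omega_sub hz), hp_cosh_re]
  exact mul_pos (Real.cosh_pos _) (hp_cos_pos (hpPsi_memS hz))

lemma hpH_nonneg (z : ℂ) : 0 ≤ hairpinH z := by
  by_cases h : z ∈ Omega1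
  · exact (hpH_pos h).le
  · exact (hpH_zero h).ge

lemma hpH_cont : Continuous hairpinH := by
  have h1 : ContinuousOn hairpinH hpK := by
    have : ContinuousOn (fun z => (Complex.cosh (hpPsi z)).re) hpK :=
      Complex.continuous_re.comp_continuousOn (Complex.continuous_cosh.comp_continuousOn hpPsi_cont)
    exact this.congr fun z hz => hpH_eq hz
  have h2 : ContinuousOn hairpinH Omega1ᶜ :=
    continuousOn_const.congr fun z hz => hpH_zero hz
  have h3 := h1.union_of_isClosed h2 hpK_closed hp_Omega_open.isClosed_compl
  rw [← continuousOn_univ]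
  refine h3.mono fun z _ => ?_
  by_cases h : z ∈ Omega1
  · exact Or.inl (hp_Omega_sub h)
  · exact Or.inr h

lemma hp_posSet : posSet univ hairpinH = Omega1 := by
  ext z
  constructor
  · rintro ⟨-, h⟩
    by_contra hn
    exact h.ne' (hpH_zero hn)
  · exact fun h => ⟨trivial, hpH_pos h⟩

/-- Local analytic extension of the inverse. -/
lemma hp_local {z : ℂ} (hz : z ∈ hpK) :
    ∃ g : ℂ → ℂ, AnalyticAt ℂ g z ∧ hpPsi =ᶠ[𝓝[hpK] z] g := by
  have hne : deriv hpP (hpPsi z) ≠ 0 := by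
    rw [(hp_deriv _).deriv]; exact hp_deriv_ne (hpPsi_mem hz)
  have ha := (hp_analytic (hpPsi z)).analyticAt_localInverse hne
  rw [hpPsi_eq hz] at ha
  refine ⟨_, ha, ?_⟩
  have h1 := (hp_analytic (hpPsi z)).hasStrictDerivAt.eventually_left_inverse hne
  have h2 := (hpPsi_cont z hz).eventually h1
  filter_upwards [h2, self_mem_nhdsWithin] with x hx hxK
  rw [hpPsi_eq hxK] at hx
  exact hx.symm

lemma hp_K_nhds {z : ℂ} (hz : z ∈ Omega1) : hpK ∈ 𝓝 z :=
  mem_of_superset (hp_Omega_open.mem_nhds hz) hp_Omega_sub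

lemma hpPsi_analytic {z : ℂ} (hz : z ∈ Omega1) : AnalyticAt ℂ hpPsi z := by
  obtain ⟨g, hg, h⟩ := hp_local (hp_Omega_sub hz)
  rw [nhdsWithin_eq_nhds.2 (hp_K_nhds hz)] at h
  exact hg.congr h.symm

noncomputable def hpF (z : ℂ) : ℂ := Complex.cosh (hpPsi z)

noncomputable def hpQ (z : ℂ) : ℂ := Complex.sinh (hpPsi z) / (1 + Complex.cosh (hpPsi z))

lemma hpQ_cont : ContinuousOn hpQ hpK :=
  (Complex.continuous_sinh.comp_continuousOn hpPsi_cont).div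
    (continuousOn_const.add (Complex.continuous_cosh.comp_continuousOn hpPsi_cont))
    fun _ hz => hp_deriv_ne (hpPsi_mem hz)

lemma hpF_deriv {z : ℂ} (hz : z ∈ Omega1) : HasDerivAt hpF (hpQ z) z := by
  have hK := hp_Omega_sub hz
  have h1 : HasDerivAt hpPsi (1 + Complex.cosh (hpPsi z))⁻¹ z := by
    refine HasDerivAt.of_local_left_inverse (hpPsi_analytic hz).continuousAt
      (hp_deriv (hpPsi z)) (hp_deriv_ne (hpPsi_mem hK)) ?_
    filter_upwards [hp_K_nhds hz] with x hx using hpPsi_eq hx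
  exact (Complex.hasDerivAt_cosh (hpPsi z)).comp z h1

lemma hpQ_analytic {z : ℂ} (hz : z ∈ Omega1) : AnalyticAt ℂ hpQ z := by
  have h := hpPsi_analytic hz
  refine AnalyticAt.div ?_ ?_ (hp_deriv_ne (hpPsi_mem (hp_Omega_sub hz)))
  · exact (Complex.differentiable_sinh.analyticAt _).comp h
  · exact analyticAt_const.add ((Complex.differentiable_cosh.analyticAt _).comp h)

lemma hp_re_fderiv {f : ℂ → ℂ} {f' z : ℂ} (h : HasDerivAt f f' z) (v : ℂ) :
    fderiv ℝ (fun x => (f x).re) z v = (f' * v).re := by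
  have h1 := (Complex.reCLM.hasFDerivAt (x := f z)).comp z
    (h.hasFDerivAt.restrictScalars ℝ)
  have h2 : fderiv ℝ (fun x => (f x).re) z = _ := h1.fderiv
  rw [h2]
  simp [mul_comm]

lemma hpH_fderiv {z : ℂ} (hz : z ∈ Omega1) (v : ℂ) :
    fderiv ℝ hairpinH z v = (hpQ z * v).re := by
  have : hairpinH =ᶠ[𝓝 z] fun x => (hpF x).re := by
    filter_upwards [hp_K_nhds hz] with x hx using hpH_eq hx
  rw [this.fderiv_eq, hp_re_fderiv (hpF_deriv hz)]

lemma hpH_grad {z : ℂ} (hz : z ∈ Omega1) : (starRingEnd ℂ) (hpQ z) = grad2 hairpinH z := by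
  unfold grad2
  rw [hpH_fderiv hz, hpH_fderiv hz]
  apply Complex.ext <;> simp

lemma hpH_hess {z : ℂ} (hz : z ∈ Omega1) (v w : ℂ) :
    hess hairpinH z v w = (deriv hpQ z * v * w).re := by
  unfold hess
  have : (fun x => fderiv ℝ hairpinH x v) =ᶠ[𝓝 z] fun x => (hpQ x * v).re := by
    filter_upwards [hp_Omega_open.mem_nhds hz] with x hx using hpH_fderiv hx v
  rw [this.fderiv_eq, hp_re_fderiv (((hpQ_analytic hz).differentiableAt.hasDerivAt).mul_const v)]

lemma hpH_smooth {z : ℂ} (hz : z ∈ hpK) (n : WithTop ℕ∞) :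
    ContDiffWithinAt ℝ n hairpinH hpK z := by
  obtain ⟨g, hg, h⟩ := hp_local hz
  have h1 : AnalyticAt ℂ (fun x => Complex.cosh (g x)) z :=
    (Complex.differentiable_cosh.analyticAt _).comp hg
  have h2 : ContDiffAt ℝ n (fun x => (Complex.cosh (g x)).re) z :=
    Complex.reCLM.contDiff.contDiffAt.comp z (h1.contDiffAt.restrict_scalars ℝ)
  refine h2.contDiffWithinAt.congr_of_eventuallyEq_of_mem ?_ hz
  filter_upwards [h, self_mem_nhdsWithin] with x hx hxK
  rw [hpH_eq hxK, hx]

lemma hpH_harm : HarmonicOn2 hairpinH Omega1 := by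
  refine ⟨fun z hz => (hpH_smooth (hp_Omega_sub hz) 2).mono hp_Omega_sub, fun z hz => ?_⟩
  rw [hpH_hess hz, hpH_hess hz]
  simp

lemma hpQ_norm {z : ℂ} (hz : z ∈ frontier Omega1) : ‖hpQ z‖ = 1 := by
  have hK : z ∈ hpK := by rw [← hp_closure]; exact frontier_subset_closure hz
  have hn : z ∉ Omega1 := by
    rw [hp_Omega_open.frontier_eq] at hz; exact hz.2
  have hb := (hp_bdry (hpPsi_bdry hK hn)).1
  have hs : Real.sin (hpPsi z).im ^ 2 = 1 := by
    have := Real.sin_sq_add_cos_sq (hpPsi z).im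
    rw [hb] at this; linarith
  unfold hpQ
  rw [norm_div]
  rw [div_eq_one_iff_eq (norm_ne_zero_iff.2 (hp_deriv_ne (hpPsi_mem hK)))]
  rw [← sq_eq_sq₀ (norm_nonneg _) (norm_nonneg _), Complex.sq_norm, Complex.sq_norm,
    Complex.normSq_apply, Complex.normSq_apply]
  simp only [Complex.add_re, Complex.add_im, Complex.one_re, Complex.one_im, hp_cosh_re, hp_cosh_im,
    hp_sinh_re, hp_sinh_im, hb]
  have := Real.cosh_sq (hpPsi z).re
  linear_combination (Real.cosh (hpPsi z).re ^ 2 - Real.sinh (hpPsi z).re ^ 2) * hs + this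

lemma hp_defining {s : ℝ} (hs : s = 1 ∨ s = -1) :
    ContDiff ℝ (⊤ : ℕ∞) (fun w : ℂ => Real.pi / 2 + Real.cosh w.re - s * w.im) ∧
    ∀ w : ℂ, fderiv ℝ (fun w : ℂ => Real.pi / 2 + Real.cosh w.re - s * w.im) w ≠ 0 := by
  have hc : ContDiff ℝ (⊤ : ℕ∞) (fun w : ℂ => Real.pi / 2 + Real.cosh w.re - s * w.im) := by
    have h1 : ContDiff ℝ (⊤ : ℕ∞) (fun w : ℂ => w.re) := Complex.reCLM.contDiff
    have h2 : ContDiff ℝ (⊤ : ℕ∞) (fun w : ℂ => w.im) := Complex.imCLM.contDiff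
    exact (contDiff_const.add (Real.contDiff_cosh.comp h1)).sub (contDiff_const.mul h2)
  refine ⟨hc, fun w h0 => ?_⟩
  have hd := (hc.differentiable (by simp) w).hasFDerivAt
  rw [h0] at hd
  have hline : HasDerivAt (fun t : ℝ => w + (t : ℂ) * I) I 0 := by
    simpa using ((hasDerivAt_id (0 : ℝ)).ofReal_comp.mul_const I).const_add w
  have hd' : HasFDerivAt (fun w : ℂ => Real.pi / 2 + Real.cosh w.re - s * w.im) (0 : ℂ →L[ℝ] ℝ)
      (w + ((0 : ℝ) : ℂ) * I) := by simpa using hd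
  have h3 := hd'.comp_hasDerivAt (0 : ℝ) hline
  have h4 : HasDerivAt (fun t : ℝ => Real.pi / 2 + Real.cosh w.re - s * (w.im + t)) (-s) 0 := by
    simpa using (((hasDerivAt_id (0 : ℝ)).const_add w.im).const_mul s).const_sub
      (Real.pi / 2 + Real.cosh w.re)
  have h5 : ((fun w : ℂ => Real.pi / 2 + Real.cosh w.re - s * w.im) ∘
      fun t : ℝ => w + (t : ℂ) * I) =
      fun t : ℝ => Real.pi / 2 + Real.cosh w.re - s * (w.im + t) := by
    ext t; simp
  rw [h5] at h3
  have := h3.unique h4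
  simp only [ContinuousLinearMap.zero_apply] at this
  rcases hs with h | h <;> rw [h] at this <;> norm_num at this

lemma hpH_manifold : ∀ z ∈ FB univ hairpinH, ∃ V : Set ℂ, IsOpen V ∧ z ∈ V ∧ V ⊆ univ ∧
    ∃ φ : ℂ → ℝ, ContDiffOn ℝ (⊤ : ℕ∞) φ V ∧ (∀ w ∈ V, fderiv ℝ φ w ≠ 0) ∧
      V ∩ posSet univ hairpinH = {w ∈ V | 0 < φ w} ∧
      V ∩ {w | hairpinH w = 0} = {w ∈ V | φ w ≤ 0} ∧
      V ∩ FB univ hairpinH = {w ∈ V | φ w = 0} := by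
  intro z hz
  unfold FB at hz ⊢
  rw [hp_posSet, univ_inter, hp_frontier] at *
  have hz' : |z.im| = Real.pi / 2 + Real.cosh z.re := hz
  have hpos : 0 < |z.im| := by
    have := Real.pi_pos; have := Real.cosh_pos z.re; rw [hz']; positivity
  obtain ⟨s, hs, hsz⟩ : ∃ s : ℝ, (s = 1 ∨ s = -1) ∧ 0 < s * z.im := by
    rcases lt_or_gt_of_ne (abs_pos.1 hpos) with h | h
    · exact ⟨-1, Or.inr rfl, by linarith⟩
    · exact ⟨1, Or.inl rfl, by linarith⟩
  have habs : ∀ w : ℂ, 0 < s * w.im → |w.im| = s * w.im := by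
    intro w hw
    rcases hs with h | h <;> rw [h] at hw ⊢
    · rw [one_mul] at hw ⊢; exact abs_of_pos hw
    · rw [abs_of_neg (by linarith)]; ring
  have hH : ∀ w : ℂ, hairpinH w = 0 ↔ w ∉ Omega1 :=
    fun w => ⟨fun h hw => (hpH_pos hw).ne' h, hpH_zero⟩
  obtain ⟨h1, h2⟩ := hp_defining hs
  refine ⟨{w | 0 < s * w.im}, isOpen_lt (by fun_prop) (by fun_prop), hsz, subset_univ _, _,
    h1.contDiffOn, fun w _ => h2 w, ?_, ?_, ?_⟩
  · ext w
    refine and_congr_right fun hw => ?_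
    show |w.im| < _ ↔ _
    rw [habs w hw, sub_pos]
  · ext w
    refine and_congr_right fun hw => ?_
    refine (hH w).trans ?_
    show ¬ (|w.im| < _) ↔ _
    rw [habs w hw, not_lt, sub_nonpos]
  · ext w
    refine and_congr_right fun hw => ?_
    show |w.im| = _ ↔ _
    rw [habs w hw, sub_eq_zero, eq_comm]

lemma hpH_classical : IsClassicalSolution Set.univ hairpinH where
  contOn := hpH_cont.continuousOn
  nonneg := fun z _ => hpH_nonneg z
  harm := by rw [hp_posSet]; exact hpH_harm
  smooth_ext := by
    refine ⟨hairpinH, ?_, fun _ _ => rfl⟩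
    rw [hp_posSet, univ_inter, hp_closure]
    exact fun z hz => hpH_smooth hz _
  fb_manifold := hpH_manifold
  grad_one := by
    intro z hz
    unfold FB at hz
    rw [hp_posSet, univ_inter] at *
    have hK : z ∈ hpK := by rw [← hp_closure]; exact frontier_subset_closure hz
    have h1 := ((hpQ_cont z hK).mono hp_Omega_sub).norm
    have h2 : Tendsto (fun w => ‖hpQ w‖) (𝓝[Omega1] z) (𝓝 ‖hpQ z‖) := h1
    rw [hpQ_norm hz] at h2
    refine h2.congr' ?_
    filter_upwards [self_mem_nhdsWithin] with w hw
    rw [← hpH_grad hw, Complex.norm_conj]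

/-- the double hairpin function `H` is well defined, continuous, positive
and harmonic on `Ω₁`, its gradient extends continuously to the closure with `|∇H| = 1`
on `∂Ω₁`, and `H` is an entire classical solution of the one-phase free boundary
problem. -/
theorem hairpin_classical_solution :
    (∀ z ∈ Omega1, ∃! w : ℂ, w ∈ Sstrip ∧ w + Complex.sinh w = z) ∧
    (∀ z ∈ Omega1, ∀ w ∈ Sstrip, w + Complex.sinh w = z →
      hairpinH z = (Complex.cosh w).re) ∧
    (∀ z : ℂ, z ∉ Omega1 → hairpinH z = 0) ∧
    Continuous hairpinH ∧
    (∀ z ∈ Omega1, 0 < hairpinH z) ∧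
    HarmonicOn2 hairpinH Omega1 ∧
    (∃ G : ℂ → ℂ, ContinuousOn G (closure Omega1) ∧
      (∀ z ∈ Omega1, G z = grad2 hairpinH z) ∧
      ∀ z ∈ frontier Omega1, ‖G z‖ = 1) ∧
    IsClassicalSolution Set.univ hairpinH := by

  refine ⟨?_, ?_, fun z hz => hpH_zero hz, hpH_cont, fun z hz => hpH_pos hz, hpH_harm, ?_,
    hpH_classical⟩
  · intro z hz
    refine ⟨hpPsi z, ⟨hpPsi_memS hz, hpPsi_eq (hp_Omega_sub hz)⟩, ?_⟩
    rintro w ⟨hw, h⟩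
    exact (hpPsi_unique (hp_Omega_sub hz) (hpS_sub_T hw) h).symm
  · intro z hz w hw h
    rw [hpH_eq (hp_Omega_sub hz), hpPsi_unique (hp_Omega_sub hz) (hpS_sub_T hw) h]
  · refine ⟨fun z => (starRingEnd ℂ) (hpQ z), ?_, fun z hz => hpH_grad hz, fun z hz => ?_⟩
    · rw [hp_closure]
      exact Complex.continuous_conj.comp_continuousOn hpQ_cont
    · rw [Complex.norm_conj]; exact hpQ_norm hz
end

section
/- Fix a > 0 and let S_a = {ζ ∈ ℂ : Re ζ > 0} ∖ {t ∈ ℝ : 0 < t ≤ a} (the right half-plane with a slit of length a removed). For ζ ∈ S_a define, using the principal branch Log of the complex logarithm, q(ζ) = exp(½ Log(ζ − a) + ½ Log(ζ + a)) and Φ_a(ζ) = q(ζ) + a·Log((ζ + q(ζ))/a). Then for every ζ ∈ S_a one has ζ − a ∉ (−∞,0], ζ + a ∉ (−∞,0], and (ζ + q(ζ))/a ∉ (−∞,0], so Φ_a is well defined and holomorphic on S_a, and its derivative satisfies Φ_a′(ζ) = exp(φ_a(ζ)) where φ_a(ζ) = −½ Log(ζ − a) + ½ Log(ζ + a). -/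
open Complex Metric Set Filter MeasureTheory
open scoped Topology Classical NNReal

theorem half_log_re_pos (z : ℂ) (hz : z ∈ Complex.slitPlane) :
    0 < (Complex.exp ((1 / 2 : ℂ) * Complex.log z)).re := by
  have e : (1 / 2 : ℂ) = ((1 / 2 : ℝ) : ℂ) := by norm_num
  rw [e, Complex.exp_re, Complex.re_ofReal_mul, Complex.im_ofReal_mul, Complex.log_im]
  have h1 := Complex.neg_pi_lt_arg z
  have h2 : Complex.arg z < Real.pi :=
    lt_of_le_of_ne (Complex.arg_le_pi z) (Complex.mem_slitPlane_iff_arg.1 hz).1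
  exact mul_pos (Real.exp_pos _) (Real.cos_pos_of_mem_Ioo ⟨by linarith, by linarith⟩)

theorem half_log_sq (z : ℂ) (hz : z ≠ 0) :
    Complex.exp ((1 / 2 : ℂ) * Complex.log z) ^ 2 = z := by
  rw [← Complex.exp_nat_mul]
  convert Complex.exp_log hz using 2
  push_cast; ring

theorem slit_aux (a : ℝ) (ha : 0 < a) (ζ : ℂ) (h1 : ζ - (a : ℂ) ∈ Complex.slitPlane)
    (h2 : ζ + (a : ℂ) ∈ Complex.slitPlane) :
    ((ζ + Complex.exp ((1 / 2 : ℂ) * Complex.log (ζ - (a : ℂ)) +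
          (1 / 2 : ℂ) * Complex.log (ζ + (a : ℂ)))) / (a : ℂ)) ∈ Complex.slitPlane ∧
      HasDerivAt
        (fun w : ℂ => Complex.exp ((1 / 2 : ℂ) * Complex.log (w - (a : ℂ)) +
            (1 / 2 : ℂ) * Complex.log (w + (a : ℂ))) +
          (a : ℂ) * Complex.log ((w + Complex.exp ((1 / 2 : ℂ) * Complex.log (w - (a : ℂ)) +
            (1 / 2 : ℂ) * Complex.log (w + (a : ℂ)))) / (a : ℂ)))
        (Complex.exp (-(1 / 2 : ℂ) * Complex.log (ζ - (a : ℂ)) +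
          (1 / 2 : ℂ) * Complex.log (ζ + (a : ℂ)))) ζ := by
  have hD : HasDerivAt (fun w : ℂ => Complex.exp ((1 / 2 : ℂ) * Complex.log (w - (a : ℂ)) +
      (1 / 2 : ℂ) * Complex.log (w + (a : ℂ)))) _ ζ :=
    (((((hasDerivAt_id ζ).sub_const (a : ℂ)).clog h1).const_mul (1 / 2 : ℂ)).add
      ((((hasDerivAt_id ζ).add_const (a : ℂ)).clog h2).const_mul (1 / 2 : ℂ))).cexp
  have p1 := half_log_re_pos _ h1
  have p2 := half_log_re_pos _ h2
  have s1 := half_log_sq _ (Complex.slitPlane_ne_zero h1)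
  have s2 := half_log_sq _ (Complex.slitPlane_ne_zero h2)
  have hs : ((ζ + Complex.exp ((1 / 2 : ℂ) * Complex.log (ζ - (a : ℂ)) +
          (1 / 2 : ℂ) * Complex.log (ζ + (a : ℂ)))) / (a : ℂ)) ∈ Complex.slitPlane := by
    rw [Complex.exp_add]
    generalize Complex.exp ((1 / 2 : ℂ) * Complex.log (ζ - (a : ℂ))) = P at *
    generalize Complex.exp ((1 / 2 : ℂ) * Complex.log (ζ + (a : ℂ))) = M at *
    have e : (ζ + P * M) / (a : ℂ) = (((1 / (2 * a) : ℝ)) : ℂ) * (P + M) ^ 2 := by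
      have ha' : (a : ℂ) ≠ 0 := by exact_mod_cast ha.ne'
      push_cast
      field_simp
      linear_combination -s1 - s2
    rw [e]
    have hc : 0 < 1 / (2 * a) := by positivity
    have hx : 0 < (P + M).re := by rw [Complex.add_re]; linarith
    generalize P + M = Q at *
    rw [Complex.mem_slitPlane_iff, Complex.re_ofReal_mul, Complex.im_ofReal_mul]
    by_cases hy : Q.im = 0
    · left
      apply mul_pos hc
      simp [pow_two, hy]
      exact hx.ne'
    · right
      apply mul_ne_zero hc.ne'
      simp only [pow_two, Complex.mul_im]
      intro h
      have : Q.re * Q.im = 0 := by linarith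
      exact (mul_ne_zero hx.ne' hy) this
  refine ⟨hs, ?_⟩
  have hF := hD.add (((((hasDerivAt_id ζ).add hD).div_const (a : ℂ)).clog hs).const_mul (a : ℂ))
  refine hF.congr_deriv ?_
  have hs0 := Complex.slitPlane_ne_zero hs
  have ha' : (a : ℂ) ≠ 0 := by exact_mod_cast ha.ne'
  simp only [id, Pi.add_apply] at *
  rw [neg_mul]
  rw [Complex.exp_add] at *
  rw [Complex.exp_add, Complex.exp_neg]
  generalize Complex.exp ((1 / 2 : ℂ) * Complex.log (ζ - (a : ℂ))) = P at *
  generalize Complex.exp ((1 / 2 : ℂ) * Complex.log (ζ + (a : ℂ))) = M at *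
  have hP : P ≠ 0 := by rintro rfl; simp at p1
  have hM : M ≠ 0 := by rintro rfl; simp at p2
  have hq : ζ + P * M ≠ 0 := fun h => hs0 (by rw [h, zero_div])
  rw [← s1, ← s2]
  have hq' : P * M * (1 / 2 * (1 / P ^ 2) + 1 / 2 * (1 / M ^ 2)) = ζ / (P * M) := by
    field_simp
    linear_combination s1 + s2
  rw [hq']
  field_simp
  linear_combination (-(ζ + P * M)) * s2

theorem mem_slit_of (a : ℝ) (ha : 0 < a) (ζ : ℂ)
    (hz : ζ ∈ ({ζ : ℂ | 0 < ζ.re} \ {ζ : ℂ | ζ.im = 0 ∧ 0 < ζ.re ∧ ζ.re ≤ a})) :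
    ζ - (a : ℂ) ∈ Complex.slitPlane ∧ ζ + (a : ℂ) ∈ Complex.slitPlane := by
  obtain ⟨h0, h1⟩ := hz
  simp only [Set.mem_setOf_eq] at h0 h1
  simp only [Complex.mem_slitPlane_iff, Complex.sub_re, Complex.add_re, Complex.sub_im,
    Complex.add_im, Complex.ofReal_re, Complex.ofReal_im, sub_zero, add_zero]
  refine ⟨?_, Or.inl (by linarith)⟩
  by_cases h : ζ.im = 0
  · left
    by_contra hc
    exact h1 ⟨h, h0, by linarith⟩
  · exact Or.inr h

theorem not_of_slit (z : ℂ) (h : z ∈ Complex.slitPlane) : ¬(z.im = 0 ∧ z.re ≤ 0) := by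
  rintro ⟨h1, h2⟩
  rcases Complex.mem_slitPlane_iff.1 h with h | h
  · linarith
  · exact h h1

/-- the conformal map `Φ_a` onto the slit half-plane is well defined and
holomorphic, with `Φ_a′ = exp(φ_a)` where
`φ_a(ζ) = −½ Log(ζ − a) + ½ Log(ζ + a)`. -/
theorem slit_halfplane_conformal_map (a : ℝ) (ha : 0 < a) :
    ∀ ζ ∈ ({ζ : ℂ | 0 < ζ.re} \ {ζ : ℂ | ζ.im = 0 ∧ 0 < ζ.re ∧ ζ.re ≤ a}),
      (¬((ζ - (a : ℂ)).im = 0 ∧ (ζ - (a : ℂ)).re ≤ 0)) ∧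
      (¬((ζ + (a : ℂ)).im = 0 ∧ (ζ + (a : ℂ)).re ≤ 0)) ∧
      (¬(((ζ + Complex.exp ((1 / 2 : ℂ) * Complex.log (ζ - (a : ℂ)) +
          (1 / 2 : ℂ) * Complex.log (ζ + (a : ℂ)))) / (a : ℂ)).im = 0 ∧
        ((ζ + Complex.exp ((1 / 2 : ℂ) * Complex.log (ζ - (a : ℂ)) +
          (1 / 2 : ℂ) * Complex.log (ζ + (a : ℂ)))) / (a : ℂ)).re ≤ 0)) ∧
      DifferentiableOn ℂ
        (fun w : ℂ => Complex.exp ((1 / 2 : ℂ) * Complex.log (w - (a : ℂ)) +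
            (1 / 2 : ℂ) * Complex.log (w + (a : ℂ))) +
          (a : ℂ) * Complex.log ((w + Complex.exp ((1 / 2 : ℂ) * Complex.log (w - (a : ℂ)) +
            (1 / 2 : ℂ) * Complex.log (w + (a : ℂ)))) / (a : ℂ)))
        ({ζ : ℂ | 0 < ζ.re} \ {ζ : ℂ | ζ.im = 0 ∧ 0 < ζ.re ∧ ζ.re ≤ a}) ∧
      HasDerivAt
        (fun w : ℂ => Complex.exp ((1 / 2 : ℂ) * Complex.log (w - (a : ℂ)) +
            (1 / 2 : ℂ) * Complex.log (w + (a : ℂ))) +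
          (a : ℂ) * Complex.log ((w + Complex.exp ((1 / 2 : ℂ) * Complex.log (w - (a : ℂ)) +
            (1 / 2 : ℂ) * Complex.log (w + (a : ℂ)))) / (a : ℂ)))
        (Complex.exp (-(1 / 2 : ℂ) * Complex.log (ζ - (a : ℂ)) +
          (1 / 2 : ℂ) * Complex.log (ζ + (a : ℂ)))) ζ := by
  intro ζ hζ
  obtain ⟨h1, h2⟩ := mem_slit_of a ha ζ hζ
  obtain ⟨h3, h4⟩ := slit_aux a ha ζ h1 h2
  refine ⟨not_of_slit _ h1, not_of_slit _ h2, not_of_slit _ h3, ?_, h4⟩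
  intro w hw
  obtain ⟨g1, g2⟩ := mem_slit_of a ha w hw
  exact (slit_aux a ha w g1 g2).2.differentiableAt.differentiableWithinAt
end

section
/- Let 0 < s < 1 and let t ∈ ℝ with |t| ≤ πs. Define D(t) = √(1 + s⁴ + 2s²·cos(t/s)), x₁(t) = (1 − s²)·log((D(t) + 2s·cos(t/(2s)))/(1 − s²)), and x₂(t) = (1 + s²)·arctan(2s·sin(t/(2s))/D(t)). Then (1 − s²)·cosh(x₁(t)/(1 − s²)) = (1 + s²)·cos(x₂(t)/(1 + s²)). (In particular, the free boundary loop of the Scherk solution S_s satisfies the equation (1 − s²)·cosh(x₁/(1 − s²)) = (1 + s²)·cos(x₂/(1 + s²)).) -/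
open Complex Metric Set Filter MeasureTheory
open scoped Topology Classical NNReal

/-- the parametrized free boundary loop of the Scherk solution `S_s`
satisfies the equation `(1 − s²) cosh(x₁/(1 − s²)) = (1 + s²) cos(x₂/(1 + s²))`. -/
theorem scherk_loop_equation (s t : ℝ) (hs0 : 0 < s) (hs1 : s < 1)
    (ht : |t| ≤ Real.pi * s) :
    (1 - s ^ 2) * Real.cosh (((1 - s ^ 2) *
        Real.log ((Real.sqrt (1 + s ^ 4 + 2 * s ^ 2 * Real.cos (t / s)) +
          2 * s * Real.cos (t / (2 * s))) / (1 - s ^ 2))) / (1 - s ^ 2)) =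
    (1 + s ^ 2) * Real.cos (((1 + s ^ 2) *
        Real.arctan (2 * s * Real.sin (t / (2 * s)) /
          Real.sqrt (1 + s ^ 4 + 2 * s ^ 2 * Real.cos (t / s)))) / (1 + s ^ 2)) := by
  have hs2 : 0 < 1 - s ^ 2 := by nlinarith
  have hs3 : 0 < 1 + s ^ 2 := by positivity
  rw [mul_div_cancel_left₀ _ hs2.ne', mul_div_cancel_left₀ _ hs3.ne']
  have hcos : Real.cos (t / s) = 2 * Real.cos (t / (2 * s)) ^ 2 - 1 := by
    rw [← Real.cos_two_mul]
    congr 1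
    field_simp
  rw [hcos]
  have hsc := Real.sin_sq_add_cos_sq (t / (2 * s))
  generalize Real.cos (t / (2 * s)) = c at *
  generalize Real.sin (t / (2 * s)) = d at *
  have hR : 1 + s ^ 4 + 2 * s ^ 2 * (2 * c ^ 2 - 1) = (1 - s ^ 2) ^ 2 + (2 * s * c) ^ 2 := by ring
  rw [hR]
  have hpos : 0 < (1 - s ^ 2) ^ 2 + (2 * s * c) ^ 2 := by positivity
  have hDpos := Real.sqrt_pos.2 hpos
  have hD2 := Real.sq_sqrt hpos.le
  generalize Real.sqrt ((1 - s ^ 2) ^ 2 + (2 * s * c) ^ 2) = D at *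
  have habs : |2 * s * c| < D := abs_lt_of_sq_lt_sq (by nlinarith [pow_pos hs2 2]) hDpos.le
  have hy : 0 < D + 2 * s * c := by linarith [(abs_lt.1 habs).1]
  have h1 : (1 - s ^ 2) * Real.cosh (Real.log ((D + 2 * s * c) / (1 - s ^ 2))) = D := by
    have hinv : ((D + 2 * s * c) / (1 - s ^ 2))⁻¹ = (D - 2 * s * c) / (1 - s ^ 2) := by
      rw [inv_div, div_eq_div_iff hy.ne' hs2.ne']
      linear_combination -hD2
    rw [Real.cosh_log (div_pos hy hs2), hinv]
    have := hs2.ne'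
    field_simp
    ring
  have h2 : (1 + (2 * s * d / D) ^ 2) = ((1 + s ^ 2) / D) ^ 2 := by
    field_simp
    linear_combination hD2 + 4 * s ^ 2 * hsc
  rw [h1, Real.cos_arctan, h2, Real.sqrt_sq (by positivity)]
  field_simp
end
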